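/- arXiv:1504.07257 — 2 statements merged into one kernel-verified Lean document; each statement's English description precedes it below -/
import Mathlib

section
/- Let R be a ring, 'C = 'C_R the set of left regular elements and a := ass_R('C). The following statements are equivalent: (1) 'C is a left denominator set of R and the classical left regular left quotient ring 'Q := 'C⁻¹R is a semisimple Artinian ring; (2) a is a semiprime ideal of R, the set 'C̄ := π('C) is a dense subset of 'C_{R̄} (where π : R → R̄ := R/a, r ↦ r + a), udim(_{R̄}R̄) < ∞, and 'C_V ≠ ∅ for every uniform left ideal V of R̄; (3) a is a semiprime ideal of R, 'C̄ is a dense subset of C_{R̄}, and the classical left quotient ring Q_{l,cl}(R̄) exists and is a semisimple Artinian ring. Moreover, if one of the equivalent conditions holds then 'C̄ is a left denominator set of R̄ with ass_{R̄}('C̄) = 0, 'C̄ is a dense subset of C_{R̄}, 'Q ≅ 'C̄⁻¹R̄ ≅ Q_{l,cl}(R̄), and 'Q is a simple ring if and only if a is a prime ideal of R. -/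
universe u

namespace Bavula

/-- The set of left regular elements of `R`. -/
def lReg (R : Type u) [Ring R] : Set R := {c : R | ∀ x : R, x * c = 0 → x = 0}

/-- The set of right regular elements of `R`. -/
def rReg (R : Type u) [Ring R] : Set R := {c : R | ∀ x : R, c * x = 0 → x = 0}

/-- The set of regular elements of `R`. -/
def reg (R : Type u) [Ring R] : Set R := lReg R ∩ rReg R

/-- `S` is a multiplicative set of `R`. -/
def IsMulSet {R : Type u} [Ring R] (S : Set R) : Prop :=
  (1 : R) ∈ S ∧ (∀ a ∈ S, ∀ b ∈ S, a * b ∈ S) ∧ (0 : R) ∉ S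

/-- `S` is a left Ore set of `R`. -/
def IsLeftOre {R : Type u} [Ring R] (S : Set R) : Prop :=
  IsMulSet S ∧ ∀ s ∈ S, ∀ r : R, ∃ s' ∈ S, ∃ r' : R, s' * r = r' * s

/-- `S` is a left denominator set of `R`. -/
def IsLeftDenom {R : Type u} [Ring R] (S : Set R) : Prop :=
  IsLeftOre S ∧ ∀ r : R, ∀ s ∈ S, r * s = 0 → ∃ t ∈ S, t * r = 0

/-- `S` is a right Ore set of `R`. -/
def IsRightOre {R : Type u} [Ring R] (S : Set R) : Prop :=
  IsMulSet S ∧ ∀ s ∈ S, ∀ r : R, ∃ s' ∈ S, ∃ r' : R, r * s' = s * r'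

/-- `S` is a right denominator set of `R`. -/
def IsRightDenom {R : Type u} [Ring R] (S : Set R) : Prop :=
  IsRightOre S ∧ ∀ r : R, ∀ s ∈ S, s * r = 0 → ∃ t ∈ S, r * t = 0

/-- `ass_R(S) = {r ∈ R | s r = 0 for some s ∈ S}`. -/
def ass {R : Type u} [Ring R] (S : Set R) : Set R := {r : R | ∃ s ∈ S, s * r = 0}

/-- `{r ∈ R | r s = 0 for some s ∈ S}` (the right-sided analogue of `ass`). -/
def rass {R : Type u} [Ring R] (S : Set R) : Set R := {r : R | ∃ s ∈ S, r * s = 0}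

/-- `S` is a (left) dense subset of `T`. -/
def DenseIn {R : Type u} [Ring R] (S T : Set R) : Prop := ∀ t ∈ T, ∃ r : R, r * t ∈ S

/-- `f : R →+* Q` realizes `Q` as the left localization `S⁻¹R` of `R` at `S`:
elements of `S` become units, every element of `Q` is a left fraction `(f s)⁻¹ * (f r)`,
and the kernel of `f` is `ass S`. -/
def IsLeftLoc {R : Type u} [Ring R] (S : Set R) {Q : Type u} [Ring Q] (f : R →+* Q) : Prop :=
  (∀ s ∈ S, IsUnit (f s)) ∧
  (∀ q : Q, ∃ s ∈ S, ∃ r : R, f s * q = f r) ∧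
  (∀ r : R, f r = 0 ↔ r ∈ ass S)

/-- `π : R →+* Q` realizes `Q` as the quotient of `R` by the set `a`
(in particular, `a` is then a two-sided ideal of `R`). -/
def IsQuotBy {R : Type u} [Ring R] (a : Set R) {Q : Type u} [Ring Q] (π : R →+* Q) : Prop :=
  Function.Surjective π ∧ ∀ r : R, π r = 0 ↔ r ∈ a

/-- A semiprime ring (no nonzero nilpotent ideals), elementwise: `x R x = 0 → x = 0`. -/
def SemiprimeRing (A : Type u) [Ring A] : Prop := ∀ x : A, (∀ r : A, x * r * x = 0) → x = 0

/-- `a` is a two-sided ideal of `R`, given as a set. -/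
def IsIdealSet {R : Type u} [Ring R] (a : Set R) : Prop :=
  (0 : R) ∈ a ∧ (∀ x ∈ a, ∀ y ∈ a, x + y ∈ a) ∧ ∀ r : R, ∀ x ∈ a, r * x ∈ a ∧ x * r ∈ a

/-- `a` is a semiprime (two-sided) ideal of `R`, i.e. `R/a` is a semiprime ring. -/
def IsSemiprimeIdealSet {R : Type u} [Ring R] (a : Set R) : Prop :=
  IsIdealSet a ∧ ∀ x : R, (∀ r : R, x * r * x ∈ a) → x ∈ a

/-- `a` is a prime (two-sided) ideal of `R`, i.e. `R/a` is a prime ring. -/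
def IsPrimeIdealSet {R : Type u} [Ring R] (a : Set R) : Prop :=
  IsIdealSet a ∧ a ≠ Set.univ ∧ ∀ x y : R, (∀ r : R, x * r * y ∈ a) → x ∈ a ∨ y ∈ a

/-- The prime radical of `A`: the intersection of all prime ideals of `A`. -/
def primeRadical (A : Type u) [Ring A] : Set A :=
  {x : A | ∀ p : Set A, IsPrimeIdealSet p → x ∈ p}

/-- The set of prime ideals of `R` minimal over `a`. -/
def minPrimesOver {R : Type u} [Ring R] (a : Set R) : Set (Set R) :=
  {p : Set R | IsPrimeIdealSet p ∧ a ⊆ p ∧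
    ∀ q : Set R, IsPrimeIdealSet q → a ⊆ q → q ⊆ p → q = p}

/-- A simple ring: nontrivial, with no two-sided ideals other than `0` and `A`. -/
def SimpleRing (A : Type u) [Ring A] : Prop :=
  (0 : A) ≠ 1 ∧ ∀ a : Set A, IsIdealSet a → a = {0} ∨ a = Set.univ

/-- A simple (left) Artinian ring. -/
def SimpleArtinianRing (A : Type u) [Ring A] : Prop := SimpleRing A ∧ IsArtinianRing A

/-- `I` is an essential left ideal of `R`. -/
def EssIdeal {R : Type u} [Ring R] (I : Submodule R R) : Prop :=
  ∀ J : Submodule R R, J ≠ ⊥ → I ⊓ J ≠ ⊥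

/-- `N` is an essential submodule of the left ideal `M`. -/
def EssIn {R : Type u} [Ring R] (N M : Submodule R R) : Prop :=
  N ≤ M ∧ ∀ W : Submodule R R, W ≤ M → W ≠ ⊥ → N ⊓ W ≠ ⊥

/-- `U` is a uniform left ideal of `R`. -/
def UniformIdeal {R : Type u} [Ring R] (U : Submodule R R) : Prop :=
  U ≠ ⊥ ∧ ∀ V W : Submodule R R, V ≤ U → W ≤ U → V ≠ ⊥ → W ≠ ⊥ → V ⊓ W ≠ ⊥

/-- `udim(_A A) < ∞`: there is a finite direct sum of uniform left ideals of `A`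
which is an essential left ideal of `A`. -/
def FinUdim (A : Type u) [Ring A] : Prop :=
  ∃ (n : ℕ) (U : Fin (n + 1) → Submodule A A),
    (∀ i, UniformIdeal (U i)) ∧
    (∀ i, U i ⊓ (⨆ j, ⨆ (_ : j ≠ i), U j) = ⊥) ∧
    EssIdeal (⨆ i, U i)

/-- `'C_V = {v ∈ V | right multiplication by v is injective on V}` for a left ideal `V`. -/
def lRegIn {R : Type u} [Ring R] (V : Submodule R R) : Set R :=
  {v : R | v ∈ V ∧ ∀ x ∈ V, x * v = 0 → x = 0}

/-- The family `P` of subsets of `R` satisfies the ascending chain condition. -/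
def AccOnSets {R : Type u} [Ring R] (P : Set (Set R)) : Prop :=
  ∀ f : ℕ → Set R, (∀ n, f n ∈ P) → (∀ n, f n ⊆ f (n + 1)) →
    ∃ N : ℕ, ∀ n : ℕ, N ≤ n → f n = f N

/-- The left annihilator of `X` in `R`. -/
def lAnn {R : Type u} [Ring R] (X : Set R) : Set R := {r : R | ∀ x ∈ X, r * x = 0}

/-- The right annihilator of `X` in `R`. -/
def rAnn {R : Type u} [Ring R] (X : Set R) : Set R := {r : R | ∀ x ∈ X, x * r = 0}

/-- A left Goldie ring: a.c.c. on left annihilators and finite left uniform dimension. -/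
def LeftGoldie (A : Type u) [Ring A] : Prop :=
  AccOnSets {B : Set A | ∃ X : Set A, B = lAnn X} ∧ FinUdim A

/-- The set of maximal left denominator sets of `A`. -/
def maxLeftDenom (A : Type u) [Ring A] : Set (Set A) :=
  {S : Set A | IsLeftDenom S ∧ ∀ T : Set A, IsLeftDenom T → S ⊆ T → S = T}

/-- `S_p = {c ∈ R | c + p ∈ C_{R/p}}`: the elements regular modulo `p`. -/
def regMod {R : Type u} [Ring R] (p : Set R) : Set R :=
  {c : R | (∀ x : R, x * c ∈ p → x ∈ p) ∧ ∀ x : R, c * x ∈ p → x ∈ p}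

/-- `I` is a right ideal of `R`, given as a set. -/
def IsRightIdealSet {R : Type u} [Ring R] (I : Set R) : Prop :=
  (0 : R) ∈ I ∧ (∀ x ∈ I, ∀ y ∈ I, x + y ∈ I) ∧ ∀ x ∈ I, ∀ r : R, x * r ∈ I

/-- The left singular ideal `ζ_l(R, a)` of `R` over `a`. -/
def leftSingularOver {R : Type u} [Ring R] (a : Set R) : Set R :=
  {r : R | ∃ I : Submodule R R, EssIdeal I ∧ a ⊆ I ∧ ∀ x ∈ I, x * r = 0}

section Goldie

variable {A : Type u} [Ring A]

lemma ne_bot_mem {I : Submodule A A} (h : I ≠ ⊥) : ∃ x ∈ I, x ≠ 0 := by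
  obtain ⟨x, hx, h0⟩ := Submodule.exists_mem_ne_zero_of_ne_bot h
  exact ⟨x, hx, h0⟩

lemma ne_bot_of {I : Submodule A A} {x : A} (hx : x ∈ I) (h0 : x ≠ 0) : I ≠ ⊥ := by
  intro h
  rw [h] at hx
  exact h0 (by simpa using hx)

/-- The colon left ideal `(K : x)`. -/
def colon (K : Submodule A A) (x : A) : Submodule A A where
  carrier := {r | r * x ∈ K}
  zero_mem' := by simp
  add_mem' := by
    intro a b ha hb
    simp only [Set.mem_ofPred_eq, add_mul] at *
    exact K.add_mem ha hb
  smul_mem' := by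
    intro c a ha
    simp only [Set.mem_ofPred_eq, smul_eq_mul, mul_assoc] at *
    exact K.smul_mem c ha

lemma mem_colon {K : Submodule A A} {x r : A} : r ∈ colon K x ↔ r * x ∈ K := Iff.rfl

lemma ess_iff {E : Submodule A A} :
    EssIdeal E ↔ ∀ x : A, x ≠ 0 → ∃ r : A, r * x ∈ E ∧ r * x ≠ 0 := by
  constructor
  · intro h x hx
    have h1 : Submodule.span A {x} ≠ ⊥ := ne_bot_of (Submodule.mem_span_singleton_self x) hx
    obtain ⟨y, hy, hy0⟩ := ne_bot_mem (h _ h1)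
    obtain ⟨hyE, hyx⟩ := Submodule.mem_inf.1 hy
    obtain ⟨r, rfl⟩ := Submodule.mem_span_singleton.1 hyx
    exact ⟨r, hyE, hy0⟩
  · intro h J hJ
    obtain ⟨x, hx, hx0⟩ := ne_bot_mem hJ
    obtain ⟨r, h1, h2⟩ := h x hx0
    exact ne_bot_of (Submodule.mem_inf.2 ⟨h1, J.smul_mem r hx⟩) h2

lemma ess_colon {E : Submodule A A} (hE : EssIdeal E) (a : A) : EssIdeal (colon E a) := by
  rw [ess_iff] at *
  intro x hx
  by_cases h : x * a = 0
  · refine ⟨1, ?_, by simpa using hx⟩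
    rw [mem_colon, one_mul, h]
    exact E.zero_mem
  · obtain ⟨r, h1, h2⟩ := hE _ h
    refine ⟨r, ?_, ?_⟩
    · rw [mem_colon, mul_assoc]; exact h1
    · intro h3
      apply h2
      rw [← mul_assoc, h3, zero_mul]

lemma ess_inf {E F : Submodule A A} (hE : EssIdeal E) (hF : EssIdeal F) : EssIdeal (E ⊓ F) := by
  rw [ess_iff] at *
  intro x hx
  obtain ⟨r, h1, h2⟩ := hE x hx
  obtain ⟨s, h3, h4⟩ := hF _ h2
  refine ⟨s * r, Submodule.mem_inf.2 ⟨?_, ?_⟩, ?_⟩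
  · rw [mul_assoc]; exact E.smul_mem s h1
  · rw [mul_assoc]; exact h3
  · rw [mul_assoc]; exact h4

lemma ess_mono {E F : Submodule A A} (hE : EssIdeal E) (h : E ≤ F) : EssIdeal F := by
  rw [ess_iff] at *
  intro x hx
  obtain ⟨r, h1, h2⟩ := hE x hx
  exact ⟨r, h h1, h2⟩

lemma uniform_colon {U K : Submodule A A} (hU : UniformIdeal U) (hK : K ⊓ U ≠ ⊥) {x : A}
    (hx : x ∈ U) : EssIdeal (colon K x) := by
  rw [ess_iff]
  intro y hy
  by_cases h : y * x = 0
  · refine ⟨1, ?_, by simpa using hy⟩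
    rw [mem_colon, one_mul, h]
    exact K.zero_mem
  · have hyx : y * x ∈ U := U.smul_mem y hx
    have h1 : Submodule.span A {y * x} ≤ U := by
      rw [Submodule.span_le]; simpa using hyx
    have h2 : Submodule.span A {y * x} ≠ ⊥ :=
      ne_bot_of (Submodule.mem_span_singleton_self _) h
    obtain ⟨z, hz, hz0⟩ := ne_bot_mem (hU.2 _ _ inf_le_right h1 hK h2)
    obtain ⟨hzK, hzs⟩ := Submodule.mem_inf.1 hz
    obtain ⟨r, rfl⟩ := Submodule.mem_span_singleton.1 hzs
    refine ⟨r, ?_, ?_⟩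
    · rw [mem_colon, mul_assoc]; exact (Submodule.mem_inf.1 hzK).1
    · intro h3
      apply hz0
      rw [smul_eq_mul, ← mul_assoc, h3, zero_mul]

/-- Partial sums of a finite family. -/
def part {n : ℕ} (U : Fin n → Submodule A A) (T : Finset (Fin n)) : Submodule A A :=
  ⨆ i ∈ T, U i

lemma part_univ {n : ℕ} (U : Fin n → Submodule A A) : part U Finset.univ = ⨆ i, U i := by
  simp [part]

lemma part_empty {n : ℕ} (U : Fin n → Submodule A A) : part U ∅ = ⊥ := by
  simp [part]

lemma part_insert {n : ℕ} (U : Fin n → Submodule A A) (T : Finset (Fin n)) (i : Fin n) :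
    part U (insert i T) = U i ⊔ part U T := by
  exact Finset.iSup_insert i T U

lemma part_indep {n : ℕ} {U : Fin n → Submodule A A}
    (hU : ∀ i, U i ⊓ (⨆ j, ⨆ (_ : j ≠ i), U j) = ⊥) {T : Finset (Fin n)} {i : Fin n}
    (hi : i ∉ T) : U i ⊓ part U T = ⊥ := by
  rw [eq_bot_iff, ← hU i]
  refine inf_le_inf_left _ ?_
  refine iSup₂_le fun j hj => ?_
  exact le_iSup₂_of_le j (fun h => hi (h ▸ hj)) le_rfl

lemma eq_zero_of_inf {I J : Submodule A A} (h : I ⊓ J = ⊥) {x : A} (hI : x ∈ I) (hJ : x ∈ J) :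
    x = 0 := by
  have : x ∈ I ⊓ J := ⟨hI, hJ⟩
  rw [h] at this
  simpa using this

/-- Every nonzero left ideal contains a uniform left ideal. -/
lemma exists_uniform {n : ℕ} {U : Fin n → Submodule A A} (hu : ∀ i, UniformIdeal (U i))
    (hU : ∀ i, U i ⊓ (⨆ j, ⨆ (_ : j ≠ i), U j) = ⊥) (hE : EssIdeal (⨆ i, U i))
    {J : Submodule A A} (hJ : J ≠ ⊥) : ∃ V ≤ J, UniformIdeal V := by
  classical
  have hne : J ⊓ part U Finset.univ ≠ ⊥ := by
    rw [part_univ, inf_comm]; exact hE J hJ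
  obtain ⟨T, hT, hmin⟩ := exists_minimal_of_wellFoundedLT
    (fun T : Finset (Fin n) => J ⊓ part U T ≠ ⊥) ⟨_, hne⟩
  have hTne : T.Nonempty := by
    rw [Finset.nonempty_iff_ne_empty]
    rintro rfl
    apply hT
    rw [part_empty, inf_bot_eq]
  obtain ⟨i, hi⟩ := hTne
  have h0 : J ⊓ part U (T.erase i) = ⊥ := by
    by_contra h
    have := hmin h (Finset.erase_subset i T)
    exact (Finset.notMem_erase i T) (this hi)
  have hTi : part U T = U i ⊔ part U (T.erase i) := by
    rw [← part_insert, Finset.insert_erase hi]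
  have hind : U i ⊓ part U (T.erase i) = ⊥ := part_indep hU (Finset.notMem_erase i T)
  refine ⟨J ⊓ part U T, inf_le_left, hT, ?_⟩
  have key : ∀ B : Submodule A A, B ≤ J ⊓ part U T → B ≠ ⊥ →
      (B ⊔ part U (T.erase i)) ⊓ U i ≠ ⊥ := by
    intro B hB hB0
    obtain ⟨b, hb, hb0⟩ := ne_bot_mem hB0
    have hb' := hB hb
    obtain ⟨hbJ, hbT⟩ := Submodule.mem_inf.1 hb'
    rw [hTi] at hbT
    obtain ⟨u, hu', w, hw, rfl⟩ := Submodule.mem_sup.1 hbT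
    refine ne_bot_of (x := u) ⟨?_, hu'⟩ ?_
    · have : u = (u + w) + (-w) := by abel
      rw [this]
      exact Submodule.add_mem_sup hb (neg_mem hw)
    · rintro rfl
      rw [zero_add] at *
      exact hb0 (eq_zero_of_inf h0 hbJ hw)
  intro B C hB hC hB0 hC0
  obtain ⟨x, hx, hx0⟩ := ne_bot_mem ((hu i).2 _ _ inf_le_right inf_le_right (key B hB hB0)
    (key C hC hC0))
  obtain ⟨⟨hxB, hxi⟩, ⟨hxC, -⟩⟩ := hx
  obtain ⟨b, hb, w, hw, h1⟩ := Submodule.mem_sup.1 hxB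
  obtain ⟨c, hc, w', hw', h2⟩ := Submodule.mem_sup.1 hxC
  have hbc : b - c = w' - w := by
    have : b + w = c + w' := by rw [h1, h2]
    rw [sub_eq_sub_iff_add_eq_add, this]; abel
  have hbc0 : b - c = 0 := by
    refine eq_zero_of_inf h0 (sub_mem (hB hb).1 (hC hc).1) ?_
    rw [hbc]; exact sub_mem hw' hw
  have hbc' : b = c := sub_eq_zero.1 hbc0
  refine ne_bot_of (x := b) ⟨hb, hbc' ▸ hc⟩ ?_
  rintro rfl
  rw [zero_add] at h1
  subst h1
  exact hx0 (eq_zero_of_inf hind hxi hw)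

/-- Left nonsingularity. -/
def NonSing (A : Type u) [Ring A] : Prop :=
  ∀ (E : Submodule A A), EssIdeal E → ∀ x : A, (∀ e ∈ E, e * x = 0) → x = 0

lemma nonSing_of {n : ℕ} {U : Fin n → Submodule A A} (hu : ∀ i, UniformIdeal (U i))
    (hU : ∀ i, U i ⊓ (⨆ j, ⨆ (_ : j ≠ i), U j) = ⊥) (hE : EssIdeal (⨆ i, U i))
    (hV : ∀ V : Submodule A A, UniformIdeal V → (lRegIn V).Nonempty) : NonSing A := by
  intro E hEE x hx
  by_contra hx0
  obtain ⟨V, hVle, hVu⟩ := exists_uniform hu hU hE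
    (ne_bot_of (Submodule.mem_span_singleton_self x) hx0)
  obtain ⟨v, hv, hvr⟩ := hV V hVu
  obtain ⟨a, rfl⟩ := Submodule.mem_span_singleton.1 (hVle hv)
  obtain ⟨w, hw, hw0⟩ := ne_bot_mem (ess_colon hEE a V hVu.1)
  obtain ⟨hwE, hwV⟩ := Submodule.mem_inf.1 hw
  apply hw0
  apply hvr w hwV
  rw [smul_eq_mul, ← mul_assoc]
  exact hx _ hwE

lemma ess_of_meet (hN : NonSing A) {n : ℕ} {U : Fin n → Submodule A A}
    (hu : ∀ i, UniformIdeal (U i)) (hE : EssIdeal (⨆ i, U i))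
    {K : Submodule A A} (hK : ∀ i, K ⊓ U i ≠ ⊥) : EssIdeal K := by
  have h1 : ∀ x ∈ ⨆ i, U i, EssIdeal (colon K x) := by
    intro x hx
    induction hx using Submodule.iSup_induction' with
    | mem i x hx => exact uniform_colon (hu i) (hK i) hx
    | zero =>
      refine ess_iff.2 fun y hy => ⟨1, ?_, by simpa using hy⟩
      rw [mem_colon, mul_zero]; exact K.zero_mem
    | add x y hx hy ihx ihy =>
      refine ess_mono (ess_inf ihx ihy) ?_
      rintro r ⟨h1, h2⟩
      rw [mem_colon, mul_add]
      exact K.add_mem h1 h2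
  rw [ess_iff]
  intro x hx
  obtain ⟨r, hr, hr0⟩ := ess_iff.1 hE x hx
  by_contra hcon
  push Not at hcon
  apply hr0
  refine hN _ (h1 _ hr) _ fun e he => ?_
  rw [← mul_assoc]
  apply hcon
  rw [mul_assoc]
  exact he

lemma ess_of_maximal (hN : NonSing A) {n : ℕ} {U : Fin n → Submodule A A}
    (hu : ∀ i, UniformIdeal (U i)) (hE : EssIdeal (⨆ i, U i))
    {L : Submodule A A} {T : Finset (Fin n)} (hT : L ⊓ part U T = ⊥)
    (hmax : ∀ i, i ∉ T → L ⊓ part U (insert i T) ≠ ⊥) : EssIdeal (L ⊔ part U T) := by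
  refine ess_of_meet hN hu hE fun i => ?_
  by_cases hi : i ∈ T
  · have : U i ≤ L ⊔ part U T := le_sup_of_le_right (le_iSup₂_of_le i hi le_rfl)
    rw [inf_eq_right.2 this]
    exact (hu i).1
  · obtain ⟨x, ⟨hxL, hxT⟩, hx0⟩ := ne_bot_mem (hmax i hi)
    rw [part_insert] at hxT
    obtain ⟨u, hu', w, hw, rfl⟩ := Submodule.mem_sup.1 hxT
    refine ne_bot_of (x := u) ⟨?_, hu'⟩ ?_
    · have : u = (u + w) + (-w) := by abel
      rw [this]
      exact Submodule.add_mem_sup hxL (neg_mem hw)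
    · rintro rfl
      rw [zero_add] at *
      exact hx0 (eq_zero_of_inf hT hxL hw)

/-- Existence of a complement up to essentiality. -/
lemma exists_compl (hN : NonSing A) {n : ℕ} {U : Fin n → Submodule A A}
    (hu : ∀ i, UniformIdeal (U i)) (hE : EssIdeal (⨆ i, U i)) (L : Submodule A A) :
    ∃ K : Submodule A A, L ⊓ K = ⊥ ∧ EssIdeal (L ⊔ K) := by
  classical
  obtain ⟨T, hT, hmax⟩ := exists_maximal_of_wellFoundedGT
    (fun T : Finset (Fin n) => L ⊓ part U T = ⊥) ⟨∅, by simp [part_empty]⟩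
  refine ⟨_, hT, ess_of_maximal hN hu hE hT fun i hi h => ?_⟩
  exact hi (hmax h (Finset.subset_insert i T) (Finset.mem_insert_self i T))

open Classical in
/-- Codimension function. -/
noncomputable def cdim {n : ℕ} (U : Fin n → Submodule A A) (L : Submodule A A) : ℕ :=
  (Finset.univ.filter fun T : Finset (Fin n) => L ⊓ part U T = ⊥).sup Finset.card

lemma cdim_le {n : ℕ} (U : Fin n → Submodule A A) (L : Submodule A A) : cdim U L ≤ n := by
  refine Finset.sup_le fun T _ => ?_
  simpa using Finset.card_le_univ T

lemma le_cdim {n : ℕ} {U : Fin n → Submodule A A} {L : Submodule A A} {T : Finset (Fin n)}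
    (h : L ⊓ part U T = ⊥) : T.card ≤ cdim U L :=
  Finset.le_sup (f := Finset.card) (by simpa using h)

lemma cdim_lt (hN : NonSing A) {n : ℕ} {U : Fin n → Submodule A A}
    (hu : ∀ i, UniformIdeal (U i)) (hE : EssIdeal (⨆ i, U i)) {L L' V : Submodule A A}
    (hV : V ≠ ⊥) (hVL : V ≤ L) (hL : L' ≤ L) (hLV : L' ⊓ V = ⊥) : cdim U L < cdim U L' := by
  classical
  obtain ⟨T, hT, hc⟩ := Finset.exists_mem_eq_sup
    (Finset.univ.filter fun T : Finset (Fin n) => L ⊓ part U T = ⊥)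
    ⟨∅, by simp [part_empty]⟩ Finset.card
  have hc' : cdim U L = T.card := by
    rw [← hc]; unfold cdim; congr
  have hT' : L ⊓ part U T = ⊥ := by simpa using hT
  rw [hc']
  by_contra hcon
  have h1 : L' ⊓ part U T = ⊥ := by
    rw [eq_bot_iff, ← hT']; exact inf_le_inf_right _ hL
  have h2 : EssIdeal (L' ⊔ part U T) := by
    refine ess_of_maximal hN hu hE h1 fun i hi h => hcon ?_
    have := le_cdim h
    rw [Finset.card_insert_of_notMem hi] at this
    omega
  obtain ⟨v, ⟨hv1, hv2⟩, hv0⟩ := ne_bot_mem (h2 V hV)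
  obtain ⟨l, hl, w, hw, rfl⟩ := Submodule.mem_sup.1 hv1
  have hw0 : w = 0 := by
    refine eq_zero_of_inf hT' ?_ hw
    have : w = (l + w) - l := by abel
    rw [this]
    exact sub_mem (hVL hv2) (hL hl)
  subst hw0
  rw [add_zero] at *
  exact hv0 (eq_zero_of_inf hLV hl hv2)

/-- The left annihilator intersected with a left ideal. -/
def annIn (L : Submodule A A) (v : A) : Submodule A A where
  carrier := {x | x ∈ L ∧ x * v = 0}
  zero_mem' := by simp
  add_mem' := by
    rintro a b ⟨ha, ha'⟩ ⟨hb, hb'⟩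
    exact ⟨L.add_mem ha hb, by rw [add_mul, ha', hb', add_zero]⟩
  smul_mem' := by
    rintro c a ⟨ha, ha'⟩
    exact ⟨L.smul_mem c ha, by rw [smul_eq_mul, mul_assoc, ha', mul_zero]⟩

lemma exists_reg_in (hN : NonSing A) {n : ℕ} {U : Fin n → Submodule A A}
    (hu : ∀ i, UniformIdeal (U i))
    (hU : ∀ i, U i ⊓ (⨆ j, ⨆ (_ : j ≠ i), U j) = ⊥) (hE : EssIdeal (⨆ i, U i))
    (hV : ∀ V : Submodule A A, UniformIdeal V → (lRegIn V).Nonempty)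
    (k : ℕ) : ∀ L : Submodule A A, n ≤ k + cdim U L → ∃ c ∈ L, ∀ x ∈ L, x * c = 0 → x = 0 := by
  induction k with
  | zero =>
    intro L hL
    by_cases h : L = ⊥
    · subst h
      exact ⟨0, zero_mem _, fun x hx _ => by simpa using hx⟩
    · have := cdim_lt hN hu hE (L := L) (L' := ⊥) h le_rfl bot_le (by simp)
      have := cdim_le U ⊥
      omega
  | succ k ih =>
    intro L hL
    by_cases h : L = ⊥
    · subst h
      exact ⟨0, zero_mem _, fun x hx _ => by simpa using hx⟩
    · obtain ⟨V, hVL, hVu⟩ := exists_uniform hu hU hE h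
      obtain ⟨v, hv, hvr⟩ := hV V hVu
      have hd : annIn L v ⊓ V = ⊥ := by
        rw [eq_bot_iff]
        rintro x ⟨hx1, hx2⟩
        simpa using hvr x hx2 hx1.2
      have hlt := cdim_lt hN hu hE (L := L) (L' := annIn L v) hVu.1 hVL (fun x hx => hx.1) hd
      obtain ⟨c, hc, hcr⟩ := ih (annIn L v) (by omega)
      refine ⟨v + c, L.add_mem (hVL hv) hc.1, fun x hx hxc => ?_⟩
      rw [mul_add] at hxc
      have h1 : x * c ∈ annIn L v := (annIn L v).smul_mem x hc
      have h2 : x * v ∈ V := V.smul_mem x hv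
      have h3 : x * c = 0 := by
        refine eq_zero_of_inf hd h1 ?_
        rw [eq_neg_of_add_eq_zero_right hxc]
        exact neg_mem h2
      refine hcr x ⟨hx, ?_⟩ h3
      rwa [h3, add_zero] at hxc

lemma ess_of_lReg (hN : NonSing A) {n : ℕ} {U : Fin n → Submodule A A}
    (hu : ∀ i, UniformIdeal (U i)) (hE : EssIdeal (⨆ i, U i)) {c : A} (hc : c ∈ lReg A) :
    EssIdeal (Submodule.span A {c}) := by
  intro J hJ hcon
  have hmem : ∀ (y x : A), x ∈ Submodule.span A {y} ↔ ∃ a, a * y = x := fun y x => by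
    rw [Submodule.mem_span_singleton]; rfl
  have hpow : ∀ (k : ℕ) (x : A), x * c ^ k = 0 → x = 0 := by
    intro k
    induction k with
    | zero => intro x hx; simpa using hx
    | succ k ih =>
      intro x hx
      rw [pow_succ, ← mul_assoc] at hx
      exact ih x (hc _ hx)
  have step : ∀ k : ℕ, cdim U (Submodule.span A {c ^ k}) <
      cdim U (Submodule.span A {c ^ (k + 1)}) := by
    intro k
    refine cdim_lt hN hu hE (V := J.map (LinearMap.toSpanSingleton A A (c ^ k))) ?_ ?_ ?_ ?_
    · obtain ⟨j, hj, hj0⟩ := ne_bot_mem hJ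
      exact ne_bot_of (Submodule.mem_map_of_mem hj) fun h => hj0 (hpow k j (by simpa using h))
    · rintro _ ⟨j, -, rfl⟩
      exact (hmem _ _).2 ⟨j, by simp⟩
    · intro x hx
      obtain ⟨a, rfl⟩ := (hmem _ _).1 hx
      exact (hmem _ _).2 ⟨a * c, by rw [pow_succ', mul_assoc]⟩
    · rw [eq_bot_iff]
      rintro x ⟨hx, j, hj, hjx⟩
      obtain ⟨a, rfl⟩ := (hmem _ _).1 hx
      have h1 : (j - a * c) * c ^ k = 0 := by
        have : j * c ^ k = a * c ^ (k + 1) := by simpa using hjx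
        rw [sub_mul, this, pow_succ', mul_assoc, sub_self]
      have h2 : j = a * c := sub_eq_zero.1 (hpow k _ h1)
      have h3 : j = 0 := eq_zero_of_inf hcon ((hmem _ _).2 ⟨a, h2.symm⟩) hj
      rw [Submodule.mem_bot, ← hjx, h3, map_zero]
  have hk : ∀ k : ℕ, k ≤ cdim U (Submodule.span A {c ^ k}) := by
    intro k
    induction k with
    | zero => exact Nat.zero_le _
    | succ k ih => exact Nat.succ_le_of_lt (lt_of_le_of_lt ih (step k))
  have h1 := hk (n + 1)
  have h2 := cdim_le U (Submodule.span A {c ^ (n + 1)})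
  omega

/-- The consequences of condition (2) used below. -/
lemma goldie_main (hfin : FinUdim A)
    (hV : ∀ V : Submodule A A, UniformIdeal V → (lRegIn V).Nonempty) :
    Nontrivial A ∧ lReg A = reg A ∧ (∀ c ∈ reg A, ∀ r : A, ∃ s ∈ reg A, ∃ r', s * r = r' * c) ∧
    (∀ L : Submodule A A, ∃ K : Submodule A A, L ⊓ K = ⊥ ∧ ∃ s ∈ reg A, s ∈ L ⊔ K) := by
  obtain ⟨n, U, hu, hU, hE⟩ := hfin
  have hN : NonSing A := nonSing_of hu hU hE hV
  have hreg : lReg A = reg A := by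
    refine Set.Subset.antisymm (fun c hc => ⟨hc, fun x hx => ?_⟩) Set.inter_subset_left
    refine hN _ (ess_of_lReg hN hu hE hc) x fun e he => ?_
    obtain ⟨a, rfl⟩ := Submodule.mem_span_singleton.1 he
    rw [smul_eq_mul, mul_assoc, hx, mul_zero]
  have hess : ∀ E : Submodule A A, EssIdeal E → ∃ s ∈ reg A, s ∈ E := by
    intro E hEE
    obtain ⟨c, hc, hcr⟩ := exists_reg_in hN hu hU hE hV (n + 1) E (by omega)
    refine ⟨c, ?_, hc⟩
    rw [← hreg]
    intro x hx
    by_contra hx0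
    obtain ⟨r, h1, h2⟩ := ess_iff.1 hEE x hx0
    exact h2 (hcr _ h1 (by rw [mul_assoc, hx, mul_zero]))
  refine ⟨?_, hreg, ?_, ?_⟩
  · obtain ⟨x, -, hx⟩ := ne_bot_mem (hu 0).1
    exact ⟨x, 0, hx⟩
  · intro c hc r
    obtain ⟨s, hs, hs'⟩ := hess _ (ess_colon (ess_of_lReg hN hu hE hc.1) r)
    obtain ⟨a, ha⟩ := Submodule.mem_span_singleton.1 (mem_colon.1 hs')
    exact ⟨s, hs, a, ha.symm⟩
  · intro L
    obtain ⟨K, h1, h2⟩ := exists_compl hN hu hE L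
    obtain ⟨s, hs, hs'⟩ := hess _ h2
    exact ⟨K, h1, s, hs, hs'⟩

end Goldie

section Loc

variable {A : Type u} [Ring A] {Q : Type u} [Ring Q] {S : Set A} {f : A →+* Q}

lemma loc_frac (h : IsLeftLoc S f) (p : Q) {s : A} (hs : s ∈ S) :
    ∃ t ∈ S, ∃ r : A, f t * p = f r * f s := by
  obtain ⟨u, hu⟩ := h.1 s hs
  obtain ⟨t, ht, r, hr⟩ := h.2.1 (p * ↑u⁻¹)
  refine ⟨t, ht, r, ?_⟩
  rw [← hr, ← hu, mul_assoc, mul_assoc, Units.inv_mul, mul_one]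

lemma loc_cancel (h : IsLeftLoc S f) {s : A} (hs : s ∈ S) {q : Q} (hq : f s * q = 0) : q = 0 :=
  (h.1 s hs).mul_right_eq_zero.1 hq

lemma loc_cancel_right (h : IsLeftLoc S f) {s : A} (hs : s ∈ S) {q : Q} (hq : q * f s = 0) :
    q = 0 :=
  (h.1 s hs).mul_left_eq_zero.1 hq

/-- The extension of a left ideal to the localization. -/
def extend (h : IsLeftLoc S f) (hS : IsMulSet S) (K : Submodule A A) : Submodule Q Q where
  carrier := {q | ∃ s ∈ S, ∃ k ∈ K, f s * q = f k}
  zero_mem' := ⟨1, hS.1, 0, K.zero_mem, by simp⟩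
  add_mem' := by
    rintro p q ⟨s, hs, k, hk, h1⟩ ⟨t, ht, l, hl, h2⟩
    obtain ⟨u, hu⟩ := h.1 t ht
    obtain ⟨a, ha, b, hb⟩ := loc_frac h (f s) ht
    refine ⟨a * s, hS.2.1 a ha s hs, a * k + b * l,
      K.add_mem (K.smul_mem a hk) (K.smul_mem b hl), ?_⟩
    rw [mul_add, map_add, map_mul, map_mul, map_mul, mul_assoc, h1, hb, mul_assoc, h2]
  smul_mem' := by
    rintro p q ⟨s, hs, k, hk, h1⟩
    obtain ⟨a, ha, b, hb⟩ := loc_frac h p hs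
    refine ⟨a, ha, b * k, K.smul_mem b hk, ?_⟩
    rw [smul_eq_mul, ← mul_assoc, hb, mul_assoc, h1, map_mul]

lemma mem_extend (h : IsLeftLoc S f) (hS : IsMulSet S) {K : Submodule A A} {q : Q} :
    q ∈ extend h hS K ↔ ∃ s ∈ S, ∃ k ∈ K, f s * q = f k := Iff.rfl

/-- The contraction of a left ideal of the localization. -/
def contract (f : A →+* Q) (L : Submodule Q Q) : Submodule A A where
  carrier := {a | f a ∈ L}
  zero_mem' := by simp
  add_mem' := by
    intro a b ha hb
    simp only [Set.mem_ofPred_eq, map_add] at *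
    exact L.add_mem ha hb
  smul_mem' := by
    intro c a ha
    simp only [Set.mem_ofPred_eq, smul_eq_mul, map_mul] at *
    exact L.smul_mem _ ha

lemma mem_contract {L : Submodule Q Q} {a : A} : a ∈ contract f L ↔ f a ∈ L := Iff.rfl

lemma semisimple_of (h : IsLeftLoc S f) (hS : IsMulSet S)
    (hc : ∀ L : Submodule A A, ∃ K : Submodule A A, L ⊓ K = ⊥ ∧ ∃ s ∈ S, s ∈ L ⊔ K) :
    IsSemisimpleRing Q := by
  have : ComplementedLattice (Submodule Q Q) := by
    refine ⟨fun L => ?_⟩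
    obtain ⟨K, hK, s, hs, hsK⟩ := hc (contract f L)
    refine ⟨extend h hS K, ?_, ?_⟩
    · rw [disjoint_iff, eq_bot_iff]
      rintro q ⟨hqL, t, ht, k, hk, h1⟩
      have hk0 : k = 0 := by
        refine eq_zero_of_inf hK ?_ hk
        rw [mem_contract, ← h1]
        exact L.smul_mem _ hqL
      rw [hk0, map_zero] at h1
      simpa using loc_cancel h ht h1
    · rw [codisjoint_iff, eq_top_iff]
      rintro q -
      obtain ⟨i, hi, k, hk, rfl⟩ := Submodule.mem_sup.1 hsK
      have h1 : f (i + k) ∈ L ⊔ extend h hS K := by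
        rw [map_add]
        refine Submodule.add_mem_sup hi ?_
        exact ⟨1, hS.1, k, hk, by simp⟩
      obtain ⟨u, hu⟩ := h.1 _ hs
      rw [← hu] at h1
      have := (L ⊔ extend h hS K).smul_mem (q * ↑u⁻¹) h1
      rwa [smul_eq_mul, mul_assoc, Units.inv_mul, mul_one] at this
  exact (isSemisimpleModule_iff Q Q).2 this

/-- Uniqueness of the localization. -/
lemma loc_unique {Q' : Type u} [Ring Q'] {g : A →+* Q'} (hS : IsLeftDenom S)
    (h : IsLeftLoc S f) (h' : IsLeftLoc S g) : Nonempty (Q ≃+* Q') := by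
  classical
  let M : Submonoid A := ⟨⟨S, fun ha hb => hS.1.1.2.1 _ ha _ hb⟩, hS.1.1.1⟩
  have hore : ∀ (r : A) (s : M), ∃ (s' : M) (r' : A), (s' : A) * r = r' * s := by
    intro r s
    obtain ⟨s', hs', r', h1⟩ := hS.1.2 s s.2 r
    exact ⟨⟨s', hs'⟩, r', h1⟩
  choose den num hdn using hore
  let _ : OreLocalization.OreSet M :=
    { ore_right_cancel := by
        intro r₁ r₂ s hrs
        obtain ⟨t, ht, h1⟩ := hS.2 (r₁ - r₂) s s.2 (by rw [sub_mul, hrs, sub_self])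
        exact ⟨⟨t, ht⟩, by rwa [mul_sub, sub_eq_zero] at h1⟩
      oreNum := num
      oreDenom := den
      ore_eq := hdn }
  have key : ∀ {P : Type u} [Ring P] {k : A →+* P}, IsLeftLoc S k →
      Nonempty (OreLocalization M A ≃+* P) := by
    intro P _ k hk
    let fS : M →* Units P := Units.liftRight ((k : A →* P).comp M.subtype)
      (fun s => (hk.1 s s.2).unit) (fun s => rfl)
    have hfS : ∀ s : M, k s = fS s := fun s => rfl
    refine ⟨RingEquiv.ofBijective (OreLocalization.universalHom k fS hfS) ⟨?_, ?_⟩⟩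
    · rw [injective_iff_map_eq_zero]
      intro x hx
      induction x using OreLocalization.ind with | _ r s
      rw [OreLocalization.universalHom_apply] at hx
      have hr : k r = 0 := by simpa using hx
      obtain ⟨t, ht, htr⟩ := (hk.2.2 r).1 hr
      rw [OreLocalization.expand r s t (by exact M.mul_mem ht s.2)]
      simp [htr]
    · intro q
      obtain ⟨s, hs, r, hr⟩ := hk.2.1 q
      refine ⟨OreLocalization.oreDiv r (⟨s, hs⟩ : M), ?_⟩
      rw [OreLocalization.universalHom_apply, ← hr, hfS ⟨s, hs⟩, ← mul_assoc]
      simp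
  obtain ⟨e⟩ := key h
  obtain ⟨e'⟩ := key h'
  exact ⟨e.symm.trans e'⟩

/-- Existence of the localization. -/
lemma loc_exists (hS : IsLeftDenom S) :
    ∃ (P : Type u) (_ : Ring P) (k : A →+* P), IsLeftLoc S k := by
  classical
  let M : Submonoid A := ⟨⟨S, fun ha hb => hS.1.1.2.1 _ ha _ hb⟩, hS.1.1.1⟩
  have hore : ∀ (r : A) (s : M), ∃ (s' : M) (r' : A), (s' : A) * r = r' * s := by
    intro r s
    obtain ⟨s', hs', r', h1⟩ := hS.1.2 s s.2 r
    exact ⟨⟨s', hs'⟩, r', h1⟩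
  choose den num hdn using hore
  let _ : OreLocalization.OreSet M :=
    { ore_right_cancel := by
        intro r₁ r₂ s hrs
        obtain ⟨t, ht, h1⟩ := hS.2 (r₁ - r₂) s s.2 (by rw [sub_mul, hrs, sub_self])
        exact ⟨⟨t, ht⟩, by rwa [mul_sub, sub_eq_zero] at h1⟩
      oreNum := num
      oreDenom := den
      ore_eq := hdn }
  refine ⟨OreLocalization M A, inferInstance, OreLocalization.numeratorRingHom, ?_, ?_, ?_⟩
  · intro s hs
    exact OreLocalization.numerator_isUnit (⟨s, hs⟩ : M)
  · intro q
    induction q using OreLocalization.ind with | _ r s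
    refine ⟨s, s.2, r, ?_⟩
    exact OreLocalization.mul_cancel
  · intro r
    change OreLocalization.oreDiv r (1 : M) = 0 ↔ _
    rw [OreLocalization.zero_def, OreLocalization.oreDiv_eq_iff]
    constructor
    · rintro ⟨u, v, h1, h2⟩
      refine ⟨v, ?_, ?_⟩
      · have : (u : A) = v := by simpa using h2
        rw [← this]; exact u.2
      · simpa using h1.symm
    · rintro ⟨s, hs, h1⟩
      refine ⟨⟨s, hs⟩, s, ?_, ?_⟩
      · simpa using h1.symm
      · simp

end Loc

section Semi

variable {A : Type u} [Ring A] {Q : Type u} [Ring Q] {S : Set A} {f : A →+* Q}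

lemma semis_idem [IsSemisimpleRing Q] (L : Submodule Q Q) :
    ∃ e ∈ L, ∀ x ∈ L, x * e = x := by
  obtain ⟨K, hK⟩ := exists_isCompl L
  have h1 : (1 : Q) ∈ L ⊔ K := by rw [hK.sup_eq_top]; trivial
  obtain ⟨e, he, k, hk, hek⟩ := Submodule.mem_sup.1 h1
  refine ⟨e, he, fun x hx => ?_⟩
  have h2 : x * k = 0 := by
    refine eq_zero_of_inf hK.inf_eq_bot ?_ (K.smul_mem x hk)
    have : x * k = x - x * e := by
      rw [eq_sub_iff_add_eq, add_comm, ← mul_add, hek, mul_one]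
    rw [this]
    exact sub_mem hx (L.smul_mem x he)
  calc x * e = x * e + x * k := by rw [h2, add_zero]
    _ = x := by rw [← mul_add, hek, mul_one]

lemma semis_prime [IsSemisimpleRing Q] (x : Q) (h : ∀ q, x * q * x = 0) : x = 0 := by
  obtain ⟨e, he, hx⟩ := semis_idem (Submodule.span Q {x})
  obtain ⟨q, rfl⟩ := Submodule.mem_span_singleton.1 he
  have := hx x (Submodule.mem_span_singleton_self x)
  rw [← this, smul_eq_mul, ← mul_assoc, h]

lemma lReg_unit [IsSemisimpleRing Q] (h : IsLeftLoc S f) (hi : Function.Injective f) {c : A}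
    (hc : c ∈ lReg A) : IsUnit (f c) := by
  have hinj : Function.Injective (LinearMap.toSpanSingleton Q Q (f c)) := by
    rw [injective_iff_map_eq_zero]
    intro q hq
    have hq' : q * f c = 0 := by simpa using hq
    obtain ⟨s, hs, r, hr⟩ := h.2.1 q
    have h1 : r * c = 0 := by
      apply hi
      rw [map_mul, ← hr, mul_assoc, hq', mul_zero, map_zero]
    rw [hc r h1, map_zero] at hr
    exact loc_cancel h hs hr
  obtain ⟨d, hd⟩ := IsArtinian.surjective_of_injective_endomorphism _ hinj 1
  have hd' : d * f c = 1 := by simpa using hd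
  exact ⟨⟨f c, d, mul_eq_one_symm hd', hd'⟩, rfl⟩

lemma unit_reg (hi : Function.Injective f) {c : A} (hc : IsUnit (f c)) : c ∈ reg A := by
  constructor
  · intro x hx
    apply hi
    rw [map_zero]
    exact hc.mul_left_eq_zero.1 (by rw [← map_mul, hx, map_zero])
  · intro x hx
    apply hi
    rw [map_zero]
    exact hc.mul_right_eq_zero.1 (by rw [← map_mul, hx, map_zero])

/-- The two-sided ideal annihilating `f A f y`. -/
def annAll (f : A →+* Q) (y : A) : Submodule Q Q where
  carrier := {q | ∀ r : A, q * f r * f y = 0}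
  zero_mem' := by simp
  add_mem' := by
    intro a b ha hb r
    rw [add_mul, add_mul, ha, hb, add_zero]
  smul_mem' := by
    intro c a ha r
    rw [smul_eq_mul, mul_assoc, mul_assoc, ← mul_assoc a, ha, mul_zero]

lemma mem_annAll {y : A} {q : Q} : q ∈ annAll f y ↔ ∀ r : A, q * f r * f y = 0 := Iff.rfl

lemma annAll_right_f {y : A} {q : Q} (hq : q ∈ annAll f y) (a : A) : q * f a ∈ annAll f y := by
  intro r
  rw [mul_assoc q, ← map_mul]
  exact hq _

lemma annAll_right [IsSemisimpleRing Q] (h : IsLeftLoc S f) {y : A} {q : Q}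
    (hq : q ∈ annAll f y) (p : Q) : q * p ∈ annAll f y := by
  obtain ⟨s, hs, r, hr⟩ := h.2.1 p
  let φ : annAll f y →ₗ[Q] annAll f y :=
    (LinearMap.toSpanSingleton Q Q (f s)).restrict (p := annAll f y) (q := annAll f y)
      (fun x hx => by simpa using annAll_right_f hx s)
  have hφ : ∀ x, ((φ x : annAll f y) : Q) = (x : Q) * f s := fun x => by
    simp [φ]
  have hinj : Function.Injective φ := by
    rw [injective_iff_map_eq_zero]
    intro x hx
    have : (x : Q) * f s = 0 := by rw [← hφ, hx]; rfl
    exact Subtype.ext (loc_cancel_right h hs this)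
  obtain ⟨z, hz⟩ := IsArtinian.surjective_of_injective_endomorphism φ hinj ⟨q, hq⟩
  have hz' : (z : Q) * f s = q := by rw [← hφ, hz]
  rw [← hz', mul_assoc, hr]
  exact annAll_right_f z.2 r

lemma semiprime_of_loc [IsSemisimpleRing Q] (h : IsLeftLoc S f) (hi : Function.Injective f) :
    SemiprimeRing A := by
  intro x hx
  apply hi
  rw [map_zero]
  apply semis_prime
  intro q
  have h1 : f x ∈ annAll f x := fun r => by rw [← map_mul, ← map_mul, hx, map_zero]
  have h2 := annAll_right h h1 q 1
  rwa [map_one, mul_one] at h2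

lemma uniform_contract (h : IsLeftLoc S f) (hi : Function.Injective f) {L : Submodule Q Q}
    (hL : IsSimpleModule Q L) : UniformIdeal (contract f L) := by
  have hat : IsAtom L := isSimpleModule_iff_isAtom.1 hL
  constructor
  · obtain ⟨q, hq, hq0⟩ := ne_bot_mem hat.1
    obtain ⟨s, hs, r, hr⟩ := h.2.1 q
    refine ne_bot_of (x := r) ?_ ?_
    · rw [mem_contract, ← hr]; exact L.smul_mem _ hq
    · rintro rfl
      rw [map_zero] at hr
      exact hq0 (loc_cancel h hs hr)
  · intro V W hV hW hV0 hW0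
    obtain ⟨v, hv, hv0⟩ := ne_bot_mem hV0
    obtain ⟨w, hw, hw0⟩ := ne_bot_mem hW0
    have hfv : f v ≠ 0 := fun h0 => hv0 (hi (by rw [h0, map_zero]))
    have hfw : f w ≠ 0 := fun h0 => hw0 (hi (by rw [h0, map_zero]))
    have hle : Submodule.span Q {f v} ≤ L := by
      rw [Submodule.span_le]; simpa using mem_contract.1 (hV hv)
    have heq : Submodule.span Q {f v} = L := by
      rcases hat.le_iff.1 hle with h0 | h0
      · exact absurd h0 (ne_bot_of (Submodule.mem_span_singleton_self _) hfv)
      · exact h0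
    have hwL : f w ∈ Submodule.span Q {f v} := by rw [heq]; exact hW hw
    obtain ⟨q, hq⟩ := Submodule.mem_span_singleton.1 hwL
    obtain ⟨s, hs, r, hr⟩ := h.2.1 q
    have h1 : s * w = r * v := by
      apply hi
      rw [map_mul, map_mul, ← hq, ← hr, smul_eq_mul, mul_assoc]
    refine ne_bot_of (x := s * w) ⟨?_, W.smul_mem s hw⟩ ?_
    · rw [h1]; exact V.smul_mem r hv
    · intro h0
      apply hfw
      apply loc_cancel h hs
      rw [← map_mul, h0, map_zero]

lemma finUdim_of_loc [IsSemisimpleRing Q] [Nontrivial Q] (h : IsLeftLoc S f) (hS : IsMulSet S)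
    (hi : Function.Injective f) : FinUdim A := by
  obtain ⟨s, hind, hsup, hsimp⟩ := IsSemisimpleModule.exists_sSupIndep_sSup_simples_eq_top Q Q
  have hfin : s.Finite := WellFoundedGT.finite_of_sSupIndep hind
  have hne : s.Nonempty := by
    rw [Set.nonempty_iff_ne_empty]
    rintro rfl
    rw [sSup_empty] at hsup
    exact bot_ne_top hsup
  have : Fintype s := hfin.fintype
  have hcard : 0 < Fintype.card s := Fintype.card_pos_iff.2 hne.to_subtype
  obtain ⟨n, hn⟩ : ∃ n, Fintype.card s = n + 1 := ⟨_, (Nat.succ_pred_eq_of_pos hcard).symm⟩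
  let e : Fin (n + 1) ≃ s := (finCongr hn.symm).trans (Fintype.equivFin s).symm
  let W : Fin (n + 1) → Submodule Q Q := fun i => (e i : Submodule Q Q)
  have hWsup : ⨆ i, W i = ⊤ := by
    rw [← hsup, sSup_eq_iSup']
    exact e.iSup_comp (g := fun x : s => (x : Submodule Q Q))
  have hWind : iSupIndep W := by
    have := ((sSupIndep_iff s).1 hind).comp e.injective
    exact this
  refine ⟨n, fun i => contract f (W i), fun i => uniform_contract h hi (hsimp _ (e i).2), ?_, ?_⟩
  · intro i
    rw [eq_bot_iff]
    rintro x ⟨hx1, hx2⟩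
    have hle : (⨆ j, ⨆ (_ : j ≠ i), contract f (W j)) ≤
        contract f (⨆ j, ⨆ (_ : j ≠ i), W j) := by
      refine iSup₂_le fun j hj y hy => ?_
      exact (le_iSup₂_of_le (f := fun j (_ : j ≠ i) => W j) j hj le_rfl) hy
    have h0 : f x = 0 := eq_zero_of_inf (hWind i).eq_bot hx1 (hle hx2)
    have : x = 0 := hi (by rw [h0, map_zero])
    simp [this]
  · have key : ∀ q ∈ ⨆ i, W i, q ∈ extend h hS (⨆ i, contract f (W i)) := by
      have hle : (⨆ i, W i) ≤ extend h hS (⨆ i, contract f (W i)) := by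
        refine iSup_le fun i q hq => ?_
        obtain ⟨s, hs, r, hr⟩ := h.2.1 q
        refine ⟨s, hs, r, ?_, hr⟩
        refine (le_iSup (fun i => contract f (W i)) i) ?_
        rw [mem_contract, ← hr]
        exact (W i).smul_mem _ hq
      exact hle
    rw [ess_iff]
    intro x hx
    have hx' : f x ∈ ⨆ i, W i := by rw [hWsup]; trivial
    obtain ⟨s, hs, k, hk, h1⟩ := key _ hx'
    have h2 : s * x = k := hi (by rw [map_mul, h1])
    refine ⟨s, by rw [h2]; exact hk, fun h0 => hx (hi ?_)⟩
    rw [map_zero]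
    apply loc_cancel h hs
    rw [← map_mul, h0, map_zero]

lemma ess_meets [IsSemisimpleRing Q] (h : IsLeftLoc S f) (hS : IsMulSet S)
    (hi : Function.Injective f) {E : Submodule A A} (hE : EssIdeal E) : ∃ s ∈ S, s ∈ E := by
  obtain ⟨C, hC⟩ := exists_isCompl (extend h hS E)
  have hC0 : C = ⊥ := by
    by_contra hne
    obtain ⟨q, hq, hq0⟩ := ne_bot_mem hne
    obtain ⟨s, hs, r, hr⟩ := h.2.1 q
    have hr0 : r ≠ 0 := by
      rintro rfl
      rw [map_zero] at hr
      exact hq0 (loc_cancel h hs hr)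
    obtain ⟨a, ha, ha0⟩ := ess_iff.1 hE r hr0
    apply ha0
    apply hi
    rw [map_zero]
    refine eq_zero_of_inf hC.inf_eq_bot ⟨1, hS.1, a * r, ha, by simp⟩ ?_
    rw [map_mul, ← hr]
    exact C.smul_mem _ (C.smul_mem _ hq)
  have h1 : (1 : Q) ∈ extend h hS E := by
    have := hC.sup_eq_top
    rw [hC0, sup_bot_eq] at this
    rw [this]; trivial
  obtain ⟨s, hs, k, hk, h2⟩ := h1
  rw [mul_one] at h2
  rw [← hi h2] at hk
  exact ⟨s, hs, hk⟩

lemma lRegIn_of_loc [IsSemisimpleRing Q] (h : IsLeftLoc S f) (hS : IsMulSet S)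
    (hi : Function.Injective f) {V : Submodule A A} (hV : UniformIdeal V) :
    (lRegIn V).Nonempty := by
  obtain ⟨x, hx, hx0⟩ := ne_bot_mem hV.1
  obtain ⟨r, hr⟩ : ∃ r, x * r * x ≠ 0 := by
    by_contra hcon
    push Not at hcon
    exact hx0 (semiprime_of_loc h hi x hcon)
  refine ⟨r * x, V.smul_mem r hx, ?_⟩
  by_contra hcon
  push Not at hcon
  obtain ⟨y, hy, hy1, hy0⟩ := hcon
  have hN : annIn V (r * x) ⊓ V ≠ ⊥ := ne_bot_of (x := y) ⟨⟨hy, hy1⟩, hy⟩ hy0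
  obtain ⟨s, hs, hs'⟩ := ess_meets h hS hi (uniform_colon hV hN hx)
  have h1 : s * x * (r * x) = 0 := hs'.2
  apply hr
  apply hi
  rw [map_zero]
  apply loc_cancel h hs
  rw [← map_mul]
  rw [show s * (x * r * x) = s * x * (r * x) by simp only [mul_assoc], h1, map_zero]

lemma simple_iff_prime [IsSemisimpleRing Q] [Nontrivial Q] (h : IsLeftLoc S f) :
    SimpleRing Q ↔ IsPrimeIdealSet (ass S) := by
  have hm : ∀ x, x ∈ ass S ↔ f x = 0 := fun x => (h.2.2 x).symm
  constructor
  · rintro ⟨h01, hsimp⟩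
    refine ⟨⟨?_, ?_, ?_⟩, ?_, ?_⟩
    · rw [hm, map_zero]
    · intro x hx y hy
      rw [hm] at *
      rw [map_add, hx, hy, add_zero]
    · intro r x hx
      rw [hm] at *
      rw [hm, map_mul, map_mul, hx, mul_zero, zero_mul]
      exact ⟨rfl, rfl⟩
    · intro hu
      have : (1 : A) ∈ ass S := by rw [hu]; trivial
      rw [hm, map_one] at this
      exact h01 this.symm
    · intro x y hxy
      simp only [hm] at *
      have hid : IsIdealSet (annAll f y : Set Q) :=
        ⟨(annAll f y).zero_mem, fun a ha b hb => (annAll f y).add_mem ha hb,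
          fun r a ha => ⟨(annAll f y).smul_mem r ha, annAll_right h ha r⟩⟩
      have hx : f x ∈ (annAll f y : Set Q) := fun r => by rw [← map_mul, ← map_mul, hxy]
      rcases hsimp _ hid with h0 | h0
      · left
        rw [h0] at hx
        exact hx
      · right
        have : (1 : Q) ∈ (annAll f y : Set Q) := by rw [h0]; trivial
        have := this 1
        simpa using this
  · rintro ⟨-, -, hp⟩
    refine ⟨zero_ne_one, fun B hB => ?_⟩
    let L : Submodule Q Q :=
      { carrier := B
        zero_mem' := hB.1
        add_mem' := fun ha hb => hB.2.1 _ ha _ hb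
        smul_mem' := fun c x hx => (hB.2.2 c x hx).1 }
    obtain ⟨e, he, hex⟩ := semis_idem L
    have heB : e ∈ B := he
    by_cases h1 : e = 1
    · right
      ext x
      refine ⟨fun _ => trivial, fun _ => ?_⟩
      have := (hB.2.2 x e heB).1
      rwa [h1, mul_one] at this
    · left
      obtain ⟨t, ht, y, hy⟩ := h.2.1 (1 - e)
      have hy0 : f y ≠ 0 := fun h0 => by
        rw [h0] at hy
        exact h1 (sub_eq_zero.1 (loc_cancel h ht hy)).symm
      ext b
      constructor
      · intro hb
        obtain ⟨s, hs, x, hx⟩ := h.2.1 b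
        have hxy : ∀ r, x * r * y ∈ ass S := by
          intro r
          rw [hm, map_mul, map_mul, ← hx, ← hy]
          have h2 : f s * b * f r * f t ∈ B :=
            (hB.2.2 _ _ (hB.2.2 _ _ (hB.2.2 _ _ hb).1).2).2
          have h3 := hex _ h2
          rw [← mul_assoc, mul_sub, mul_one, h3, sub_self]
        rcases hp x y hxy with h4 | h4
        · rw [hm] at h4
          rw [h4] at hx
          exact loc_cancel h hs hx
        · exact absurd ((hm y).1 h4) hy0
      · intro hb
        rw [Set.mem_singleton_iff.1 hb]
        exact hB.1

end Semi

section Final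

variable {R : Type u} [Ring R]

/-- Condition (1). -/
lemma cond_descend {Q : Type u} [Ring Q] {f : R →+* Q} (h : IsLeftLoc (lReg R) f)
    {Rb : Type u} [Ring Rb] {π : R →+* Rb} (hπ : IsQuotBy (ass (lReg R)) π) :
    ∃ g : Rb →+* Q, Function.Injective g ∧ (∀ r, g (π r) = f r) ∧
      IsLeftLoc (π '' lReg R) g := by
  obtain ⟨hsurj, hker⟩ := hπ
  have hle : ∀ a b, π a = π b → f a = f b := by
    intro a b hab
    rw [← sub_eq_zero, ← map_sub, h.2.2, ← hker, map_sub, hab, sub_self]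
  choose σ hσ using hsurj
  let g : Rb →+* Q :=
    { toFun := fun x => f (σ x)
      map_one' := by rw [← map_one f]; exact hle _ _ (by rw [hσ, map_one])
      map_zero' := by rw [← map_zero f]; exact hle _ _ (by rw [hσ, map_zero])
      map_mul' := fun x y => by
        rw [← map_mul f]; exact hle _ _ (by rw [hσ, map_mul, hσ, hσ])
      map_add' := fun x y => by
        rw [← map_add f]; exact hle _ _ (by rw [hσ, map_add, hσ, hσ]) }
  have hg : ∀ r, g (π r) = f r := fun r => hle _ _ (hσ _)
  have hinj : Function.Injective g := by
    rw [injective_iff_map_eq_zero]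
    intro x hx
    rw [← hσ x, hg, h.2.2, ← hker] at hx
    rw [← hσ x, hx]
  refine ⟨g, hinj, hg, ?_, ?_, ?_⟩
  · rintro _ ⟨s, hs, rfl⟩
    rw [hg]; exact h.1 s hs
  · intro q
    obtain ⟨s, hs, r, hr⟩ := h.2.1 q
    exact ⟨π s, ⟨s, hs, rfl⟩, π r, by rw [hg, hg, hr]⟩
  · intro x
    constructor
    · intro hx
      obtain ⟨r, rfl⟩ : ∃ r, π r = x := ⟨_, hσ x⟩
      rw [hg, h.2.2] at hx
      obtain ⟨s, hs, hsr⟩ := hx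
      exact ⟨π s, ⟨s, hs, rfl⟩, by rw [← map_mul, hsr, map_zero]⟩
    · rintro ⟨_, ⟨s, hs, rfl⟩, hsx⟩
      have : f s * g x = 0 := by rw [← hg, ← map_mul, hsx, map_zero]
      exact loc_cancel h hs this

lemma one_mem_lReg : (1 : R) ∈ lReg R := fun x hx => by simpa using hx

lemma mul_mem_lReg {a b : R} (ha : a ∈ lReg R) (hb : b ∈ lReg R) : a * b ∈ lReg R :=
  fun x hx => ha x (hb _ (by rwa [mul_assoc]))

lemma mulSet_reg [Nontrivial R] : IsMulSet (reg R) := by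
  refine ⟨⟨one_mem_lReg, fun x hx => by simpa using hx⟩, fun a ha b hb =>
    ⟨mul_mem_lReg ha.1 hb.1, fun x hx => hb.2 _ (ha.2 _ (by rwa [← mul_assoc]))⟩, fun h => ?_⟩
  exact one_ne_zero (h.1 1 (by simp))

lemma mulSet_lReg [Nontrivial R] : IsMulSet (lReg R) := by
  refine ⟨one_mem_lReg, fun a ha b hb => mul_mem_lReg ha hb, fun h => ?_⟩
  exact one_ne_zero (h 1 (by simp))

lemma nontrivial_of_denom (h : IsLeftDenom (lReg R)) {Q : Type u} [Ring Q] {f : R →+* Q}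
    (hf : IsLeftLoc (lReg R) f) : Nontrivial Q := by
  refine ⟨1, 0, fun h0 => ?_⟩
  rw [← map_one f, hf.2.2] at h0
  obtain ⟨s, hs, hs1⟩ := h0
  rw [mul_one] at hs1
  exact h.1.1.2.2 (hs1 ▸ hs)

lemma mulSet_image (h : IsLeftDenom (lReg R)) {Rb : Type u} [Ring Rb] {π : R →+* Rb}
    (hπ : IsQuotBy (ass (lReg R)) π) : IsMulSet (π '' lReg R) := by
  refine ⟨⟨1, one_mem_lReg, map_one π⟩, ?_, ?_⟩
  · rintro _ ⟨a, ha, rfl⟩ _ ⟨b, hb, rfl⟩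
    exact ⟨a * b, mul_mem_lReg ha hb, map_mul π a b⟩
  · rintro ⟨a, ha, h0⟩
    obtain ⟨s, hs, hsa⟩ := (hπ.2 a).1 h0
    exact h.1.1.2.2 (hsa ▸ mul_mem_lReg hs ha)

/-- All facts about the quotient under condition (1). -/
lemma cond_facts (h : IsLeftDenom (lReg R)) {Q : Type u} [Ring Q] [IsSemisimpleRing Q]
    {f : R →+* Q} (hf : IsLeftLoc (lReg R) f)
    {Rb : Type u} [Ring Rb] {π : R →+* Rb} (hπ : IsQuotBy (ass (lReg R)) π) :
    SemiprimeRing Rb ∧ lReg Rb = reg Rb ∧ π '' lReg R ⊆ reg Rb ∧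
      DenseIn (π '' lReg R) (reg Rb) ∧ FinUdim Rb ∧
      (∀ V : Submodule Rb Rb, UniformIdeal V → (lRegIn V).Nonempty) ∧
      IsLeftOre (reg Rb) ∧ IsLeftDenom (π '' lReg R) ∧ ass (π '' lReg R) = {0} ∧
      ∃ g : Rb →+* Q, IsLeftLoc (reg Rb) g := by
  have : Nontrivial Q := nontrivial_of_denom h hf
  obtain ⟨g, hi, hg, hl⟩ := cond_descend hf hπ
  have hS := mulSet_image h hπ
  have : Nontrivial Rb := g.domain_nontrivial
  have hsub : π '' lReg R ⊆ reg Rb := fun c hc => unit_reg hi (hl.1 c hc)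
  have hass : ∀ x, x ∈ ass (π '' lReg R) → x = 0 := by
    rintro x ⟨s, hs, hx⟩
    exact (hsub hs).2 x hx
  have hore : ∀ c, IsUnit (g c) → ∀ r : Rb, ∃ s' ∈ π '' lReg R, ∃ r' : Rb, s' * r = r' * c := by
    rintro c ⟨u, hu⟩ r
    obtain ⟨s, hs, r', hr⟩ := hl.2.1 (g r * ↑u⁻¹)
    refine ⟨s, hs, r', hi ?_⟩
    rw [map_mul, map_mul, ← hr, ← hu, mul_assoc, mul_assoc, Units.inv_mul, mul_one]
  refine ⟨semiprime_of_loc hl hi, ?_, hsub, ?_, finUdim_of_loc hl hS hi,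
    fun V hV => lRegIn_of_loc hl hS hi hV, ⟨mulSet_reg, ?_⟩, ⟨⟨hS, ?_⟩, ?_⟩, ?_, g, ?_, ?_, ?_⟩
  · exact Set.Subset.antisymm (fun c hc => unit_reg hi (lReg_unit hl hi hc)) Set.inter_subset_left
  · intro c hc
    obtain ⟨u, hu⟩ := lReg_unit hl hi hc.1
    obtain ⟨s, hs, r, hr⟩ := hl.2.1 (↑u⁻¹ : Q)
    refine ⟨r, ?_⟩
    have : r * c = s := hi (by rw [map_mul, ← hr, ← hu, mul_assoc, Units.inv_mul, mul_one])
    rw [this]; exact hs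
  · intro c hc r
    obtain ⟨s, hs, r', h1⟩ := hore c (lReg_unit hl hi hc.1) r
    exact ⟨s, hsub hs, r', h1⟩
  · intro c hc r
    exact hore c (hl.1 c hc) r
  · intro r s hs hrs
    exact ⟨1, hS.1, by rw [(hsub hs).1 r hrs, mul_zero]⟩
  · ext x
    refine ⟨hass x, ?_⟩
    intro hx
    rw [Set.mem_singleton_iff.1 hx]
    exact ⟨1, hS.1, mul_zero _⟩
  · intro c hc
    exact lReg_unit hl hi hc.1
  · intro q
    obtain ⟨s, hs, r, hr⟩ := hl.2.1 q
    exact ⟨s, hsub hs, r, hr⟩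
  · intro x
    constructor
    · intro hx
      have : x = 0 := hi (by rw [hx, map_zero])
      rw [this]
      exact ⟨1, mulSet_reg.1, mul_zero _⟩
    · rintro ⟨s, hs, hx⟩
      rw [hs.2 x hx, map_zero]

lemma exists_quot {Q : Type u} [Ring Q] {f : R →+* Q} (hf : IsLeftLoc (lReg R) f) :
    ∃ (Rb : Type u) (_ : Ring Rb) (π : R →+* Rb), IsQuotBy (ass (lReg R)) π := by
  refine ⟨f.range, inferInstance, f.rangeRestrict, f.rangeRestrict_surjective, fun r => ?_⟩
  rw [← hf.2.2, Subtype.ext_iff]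
  rfl

/-- A localization of the quotient gives one of `R`. -/
lemma loc_comp {Rb : Type u} [Ring Rb] {π : R →+* Rb} (hπ : IsQuotBy (ass (lReg R)) π)
    {T : Set Rb} (hsub : π '' lReg R ⊆ T) (hT : T ⊆ rReg Rb) (hd : DenseIn (π '' lReg R) T)
    {Q : Type u} [Ring Q] {g : Rb →+* Q} (hg : IsLeftLoc T g) :
    IsLeftLoc (lReg R) (g.comp π) := by
  refine ⟨fun s hs => hg.1 _ (hsub ⟨s, hs, rfl⟩), ?_, ?_⟩
  · intro q
    obtain ⟨c, hc, r, hr⟩ := hg.2.1 q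
    obtain ⟨a, s, hs, hsa⟩ := hd c hc
    obtain ⟨b, hb⟩ := hπ.1 (a * r)
    refine ⟨s, hs, b, ?_⟩
    rw [RingHom.comp_apply, RingHom.comp_apply, hsa, hb, map_mul, map_mul, mul_assoc, hr]
  · intro r
    rw [RingHom.comp_apply, hg.2.2, ← hπ.2]
    constructor
    · rintro ⟨s, hs, h0⟩
      exact hT hs _ h0
    · intro h0
      exact ⟨π 1, hsub ⟨1, one_mem_lReg, rfl⟩, by rw [h0, mul_zero]⟩

/-- (3) implies that the left regular elements form a left denominator set. -/
lemma denom_of_quot {Rb : Type u} [Ring Rb] {π : R →+* Rb} (hπ : IsQuotBy (ass (lReg R)) π)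
    (hd : DenseIn (π '' lReg R) (reg Rb)) (hsub : π '' lReg R ⊆ reg Rb)
    (hore : IsLeftOre (reg Rb)) : IsLeftDenom (lReg R) := by
  have hnt : Nontrivial R := by
    by_contra hcon
    rw [not_nontrivial_iff_subsingleton] at hcon
    apply hore.1.2.2
    have h1 : (0 : R) = 1 := Subsingleton.elim _ _
    have h2 : (0 : Rb) = 1 := by rw [← map_zero π, h1, map_one]
    rw [h2]
    exact hore.1.1
  refine ⟨⟨mulSet_lReg, ?_⟩, ?_⟩
  · intro s hs r
    obtain ⟨c, hc, b, hcb⟩ := hore.2 (π s) (hsub ⟨s, hs, rfl⟩) (π r)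
    obtain ⟨a, t, ht, hta⟩ := hd c hc
    obtain ⟨d, hdd⟩ := hπ.1 (a * b)
    have h1 : π (t * r - d * s) = 0 := by
      rw [map_sub, map_mul, map_mul, hta, hdd, mul_assoc, hcb, mul_assoc, sub_self]
    obtain ⟨w, hw, hw0⟩ := (hπ.2 _).1 h1
    refine ⟨w * t, mul_mem_lReg hw ht, w * d, ?_⟩
    rw [mul_sub, sub_eq_zero] at hw0
    rw [mul_assoc, hw0, mul_assoc]
  · intro r s hs hrs
    exact ⟨1, one_mem_lReg, by rw [hs r hrs, mul_zero]⟩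

end Final

/-- Theorem 1.1 (28Feb15): semisimplicity criterion for the classical left regular
left quotient ring `'Q_{l,cl}(R) = 'C_R⁻¹R`. -/
theorem classicalLeftRegularLeftQuotient_semisimple_iff {R : Type u} [Ring R] :
    -- (1) ↔ (2)
    ((IsLeftDenom (lReg R) ∧
        ∃ (Q : Type u) (_ : Ring Q) (f : R →+* Q),
          IsLeftLoc (lReg R) f ∧ IsSemisimpleRing Q) ↔
      (∃ (Rb : Type u) (_ : Ring Rb) (π : R →+* Rb),
        IsQuotBy (ass (lReg R)) π ∧
        SemiprimeRing Rb ∧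
        (π '' lReg R ⊆ lReg Rb ∧ DenseIn (π '' lReg R) (lReg Rb)) ∧
        FinUdim Rb ∧
        ∀ V : Submodule Rb Rb, UniformIdeal V → (lRegIn V).Nonempty)) ∧
    -- (1) ↔ (3)
    ((IsLeftDenom (lReg R) ∧
        ∃ (Q : Type u) (_ : Ring Q) (f : R →+* Q),
          IsLeftLoc (lReg R) f ∧ IsSemisimpleRing Q) ↔
      (∃ (Rb : Type u) (_ : Ring Rb) (π : R →+* Rb),
        IsQuotBy (ass (lReg R)) π ∧
        SemiprimeRing Rb ∧
        (π '' lReg R ⊆ reg Rb ∧ DenseIn (π '' lReg R) (reg Rb)) ∧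
        IsLeftOre (reg Rb) ∧
        ∃ (Q : Type u) (_ : Ring Q) (g : Rb →+* Q),
          IsLeftLoc (reg Rb) g ∧ IsSemisimpleRing Q)) ∧
    -- Moreover, if one of the equivalent conditions holds:
    ((IsLeftDenom (lReg R) ∧
        ∃ (Q : Type u) (_ : Ring Q) (f : R →+* Q),
          IsLeftLoc (lReg R) f ∧ IsSemisimpleRing Q) →
      (∃ (Rb : Type u) (_ : Ring Rb) (π : R →+* Rb), IsQuotBy (ass (lReg R)) π) ∧
      ∀ (Rb : Type u) (_ : Ring Rb) (π : R →+* Rb), IsQuotBy (ass (lReg R)) π →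
        IsLeftDenom (π '' lReg R) ∧
        ass (π '' lReg R) = {0} ∧
        π '' lReg R ⊆ reg Rb ∧
        DenseIn (π '' lReg R) (reg Rb) ∧
        ∀ (Q1 : Type u) (_ : Ring Q1) (f1 : R →+* Q1), IsLeftLoc (lReg R) f1 →
          (∀ (Q2 : Type u) (_ : Ring Q2) (f2 : Rb →+* Q2),
            IsLeftLoc (π '' lReg R) f2 → Nonempty (Q1 ≃+* Q2)) ∧
          (∀ (Q3 : Type u) (_ : Ring Q3) (f3 : Rb →+* Q3),
            IsLeftLoc (reg Rb) f3 → Nonempty (Q1 ≃+* Q3)) ∧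
          (SimpleRing Q1 ↔ IsPrimeIdealSet (ass (lReg R)))) := by
  have h13 : (IsLeftDenom (lReg R) ∧
        ∃ (Q : Type u) (_ : Ring Q) (f : R →+* Q),
          IsLeftLoc (lReg R) f ∧ IsSemisimpleRing Q) ↔
      (∃ (Rb : Type u) (_ : Ring Rb) (π : R →+* Rb),
        IsQuotBy (ass (lReg R)) π ∧
        SemiprimeRing Rb ∧
        (π '' lReg R ⊆ reg Rb ∧ DenseIn (π '' lReg R) (reg Rb)) ∧
        IsLeftOre (reg Rb) ∧
        ∃ (Q : Type u) (_ : Ring Q) (g : Rb →+* Q),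
          IsLeftLoc (reg Rb) g ∧ IsSemisimpleRing Q) := by
    constructor
    · rintro ⟨hden, Q, _, f, hf, hss⟩
      obtain ⟨Rb, _, π, hπ⟩ := exists_quot hf
      obtain ⟨h1, h2, h3, h4, h5, h6, h7, h8, h9, g, hg⟩ := cond_facts hden hf hπ
      exact ⟨Rb, _, π, hπ, h1, ⟨h3, h4⟩, h7, Q, _, g, hg, hss⟩
    · rintro ⟨Rb, _, π, hπ, h1, ⟨h3, h4⟩, h7, Q, _, g, hg, hss⟩
      exact ⟨denom_of_quot hπ h4 h3 h7, Q, _, g.comp π,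
        loc_comp hπ h3 Set.inter_subset_right h4 hg, hss⟩
  refine ⟨⟨?_, ?_⟩, h13, ?_⟩
  · rintro ⟨hden, Q, _, f, hf, hss⟩
    obtain ⟨Rb, _, π, hπ⟩ := exists_quot hf
    obtain ⟨h1, h2, h3, h4, h5, h6, h7, h8, h9, g, hg⟩ := cond_facts hden hf hπ
    refine ⟨Rb, _, π, hπ, h1, ?_, h5, h6⟩
    rw [h2]
    exact ⟨h3, h4⟩
  · rintro ⟨Rb, _, π, hπ, h1, hsd, hfin, hV⟩
    rw [h13]
    obtain ⟨hnt, hreg, hore, hcompl⟩ := goldie_main hfin hV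
    rw [hreg] at hsd
    have hO : IsLeftOre (reg Rb) := ⟨mulSet_reg, hore⟩
    have hD : IsLeftDenom (reg Rb) :=
      ⟨hO, fun r s hs hrs => ⟨1, mulSet_reg.1, by rw [hs.1 r hrs, mul_zero]⟩⟩
    obtain ⟨Q, _, g, hg⟩ := loc_exists hD
    exact ⟨Rb, _, π, hπ, h1, hsd, hO, Q, _, g, hg, semisimple_of hg mulSet_reg hcompl⟩
  · rintro ⟨hden, Q, _, f, hf, hss⟩
    refine ⟨exists_quot hf, ?_⟩
    intro Rb _ π hπ
    obtain ⟨h1, h2, h3, h4, h5, h6, h7, h8, h9, g, hg⟩ := cond_facts hden hf hπ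
    refine ⟨h8, h9, h3, h4, ?_⟩
    intro Q1 _ f1 hf1
    refine ⟨?_, ?_, ?_⟩
    · intro Q2 _ f2 hf2
      refine loc_unique hden hf1 (loc_comp hπ subset_rfl
        (h3.trans Set.inter_subset_right) ?_ hf2)
      intro t ht
      exact ⟨1, by rwa [one_mul]⟩
    · intro Q3 _ f3 hf3
      exact loc_unique hden hf1 (loc_comp hπ h3 Set.inter_subset_right h4 hf3)
    · obtain ⟨e⟩ := loc_unique hden hf hf1
      have : IsSemisimpleRing Q1 := e.isSemisimpleRing
      have : Nontrivial Q1 := nontrivial_of_denom hden hf1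
      exact simple_iff_prime hf1

end Bavula
end

section
/- Let R be a ring and 'C := 'C_R. Suppose that udim(_R R) < ∞ and 'C_U ≠ ∅ for all uniform left ideals U of R. Then: (1) 'C is a left denominator set of R with ass_R('C) = a (where a := ass_R('C), which in particular is an ideal of R), and the ring 'Q := 'C⁻¹R is a semisimple Artinian ring; (2) 'Q ≅ Q_{l,cl}(R/a), an R-isomorphism; (3) for every essential left ideal I of R, I ∩ 'C ≠ ∅; (4) the prime radical n_R of R is contained in the ideal a. -/
universe u

namespace Bavula

section Aux

variable {R : Type u} [Ring R]

lemma aux_ess {ι : Type} [Fintype ι] [DecidableEq ι] (U : ι → Submodule R R)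
    (hU : ∀ i, UniformIdeal (U i))
    (hind : ∀ i, U i ⊓ (⨆ j, ⨆ (_ : j ≠ i), U j) = ⊥)
    (hess : EssIdeal (⨆ i, U i)) (E : Submodule R R) (hE : ∀ i, E ⊓ U i ≠ ⊥) :
    EssIdeal E := by
  have key : ∀ J : Finset ι, ∀ x ∈ (⨆ j ∈ J, U j), x ≠ 0 → ∃ r : R, r * x ∈ E ∧ r * x ≠ 0 := by
    intro J
    induction J using Finset.induction_on with
    | empty => intro x hx h0; simp at hx; exact absurd hx h0
    | insert i J hi ih =>
      intro x hx h0
      rw [Finset.iSup_insert] at hx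
      obtain ⟨u, hu, y, hy, rfl⟩ := Submodule.mem_sup.1 hx
      have hdis : ∀ v ∈ U i, ∀ z ∈ (⨆ j ∈ J, U j), v + z = 0 → z = 0 := by
        intro v hv z hz hvz
        have hz' : z ∈ U i := by
          have : z = -v := by rw [eq_neg_iff_add_eq_zero, add_comm]; exact hvz
          rw [this]; exact (U i).neg_mem hv
        have hz'' : z ∈ (⨆ j, ⨆ (_ : j ≠ i), U j) := by
          refine (iSup_mono fun j => ?_ : (⨆ j ∈ J, U j) ≤ _) hz
          exact iSup_le fun hj => le_iSup_of_le (by rintro rfl; exact hi hj) le_rfl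
        have : z ∈ U i ⊓ (⨆ j, ⨆ (_ : j ≠ i), U j) := ⟨hz', hz''⟩
        rw [hind] at this
        simpa using this
      by_cases hu0 : u = 0
      · subst hu0
        simp only [zero_add] at h0 ⊢
        exact ih y hy h0
      · have h1 := (hU i).2 (Submodule.span R {u}) (E ⊓ U i)
          (by simpa [Submodule.span_le] using hu) inf_le_right (by simpa using hu0) (hE i)
        obtain ⟨v, ⟨hv1, hv2⟩, hv0⟩ := (Submodule.ne_bot_iff _).1 h1
        obtain ⟨r, rfl⟩ := Submodule.mem_span_singleton.1 hv1
        simp only [smul_eq_mul] at hv0 hv2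
        by_cases hry : r * y = 0
        · exact ⟨r, by rw [mul_add, hry, add_zero]; exact hv2.1,
            by rw [mul_add, hry, add_zero]; exact hv0⟩
        · obtain ⟨s, hs, hs0⟩ := ih (r * y) (Submodule.smul_mem _ r hy) hry
          refine ⟨s * r, ?_, ?_⟩
          · rw [mul_add, mul_assoc, mul_assoc]
            exact E.add_mem (E.smul_mem s hv2.1) hs
          · intro h
            rw [mul_add, mul_assoc, mul_assoc] at h
            exact hs0 (hdis _ ((U i).smul_mem s hv2.2) _
              (Submodule.smul_mem _ s (Submodule.smul_mem _ r hy)) h)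
  intro X hX
  obtain ⟨x, hx, hx0⟩ := (Submodule.ne_bot_iff _).1 (hess X hX)
  obtain ⟨r, hr, hr0⟩ := key Finset.univ x (by simpa using hx.1) hx0
  exact (Submodule.ne_bot_iff _).2 ⟨r * x, ⟨hr, X.smul_mem r hx.2⟩, hr0⟩

lemma aux_dim (hud : FinUdim R) : ∃ (N : ℕ) (d : Submodule R R → ℕ), (∀ W, d W ≤ N) ∧
    ∀ W X W' : Submodule R R, W ≤ W' → X ≤ W' → X ≠ ⊥ → Disjoint W X → d W' < d W := by
  classical
  obtain ⟨n, U, hU, hind, hess⟩ := hud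
  let F : Submodule R R → Finset (Finset (Fin (n + 1))) := fun W =>
    Finset.univ.filter fun J => Disjoint W (⨆ j ∈ J, U j)
  have hF : ∀ W J, J ∈ F W ↔ Disjoint W (⨆ j ∈ J, U j) := by intro W J; simp [F]
  refine ⟨n + 1, fun W => (F W).sup Finset.card, ?_, ?_⟩
  · intro W
    refine Finset.sup_le fun J _ => ?_
    simpa using Finset.card_le_univ J
  · intro W X W' hW hX hX0 hWX
    obtain ⟨J, hJ, hJc⟩ := Finset.exists_mem_eq_sup (F W') ⟨∅, by rw [hF]; simp⟩ Finset.card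
    change (F W').sup Finset.card < (F W).sup Finset.card
    rw [hJc]
    by_contra hlt
    rw [hF] at hJ
    have hE : EssIdeal (W ⊔ ⨆ j ∈ J, U j) := by
      refine aux_ess U hU hind hess _ fun i h => ?_
      by_cases hi : i ∈ J
      · have : U i ≤ W ⊔ ⨆ j ∈ J, U j := le_sup_of_le_right (le_biSup U hi)
        rw [inf_eq_right.2 this] at h
        exact (hU i).1 h
      · have h2 : Disjoint W (⨆ j ∈ insert i J, U j) := by
          rw [Finset.iSup_insert, sup_comm]
          exact Disjoint.disjoint_sup_right_of_disjoint_sup_left (hJ.mono_left hW)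
            (disjoint_iff.2 h)
        have h3 := Finset.le_sup (f := Finset.card) ((hF W _).2 h2)
        rw [Finset.card_insert_of_notMem hi] at h3
        omega
    refine hE X hX0 ?_
    rw [eq_bot_iff]
    rintro x ⟨hx, hxX⟩
    obtain ⟨w, hw, y, hy, rfl⟩ := Submodule.mem_sup.1 hx
    have hy' : y ∈ W' := by
      have := W'.sub_mem (hX hxX) (hW hw)
      simpa using this
    have hy0 : y = 0 := Submodule.disjoint_def.1 hJ y hy' hy
    subst hy0
    simp only [add_zero] at hxX ⊢
    simpa using Submodule.disjoint_def.1 hWX w hw hxX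

lemma aux_uniform (hud : FinUdim R) (K : Submodule R R) (hK : K ≠ ⊥) :
    ∃ U ≤ K, UniformIdeal U := by
  obtain ⟨N, d, hN, hd⟩ := aux_dim hud
  obtain ⟨W, ⟨hWK, hW0⟩, hmin⟩ := (measure fun W : Submodule R R => N - d W).wf.has_min
    {W | W ≤ K ∧ W ≠ ⊥} ⟨K, le_rfl, hK⟩
  refine ⟨W, hWK, hW0, fun V X hV hX hV0 hX0 h => ?_⟩
  have h1 := hd V X W hV hX hX0 (disjoint_iff.2 h)
  have h2 := hmin V ⟨hV.trans hWK, hV0⟩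
  have h3 := hN V
  change ¬ (N - d V < N - d W) at h2
  omega

lemma aux_ess_meets (hud : FinUdim R)
    (huni : ∀ U : Submodule R R, UniformIdeal U → (lRegIn U).Nonempty)
    (I : Submodule R R) (hI : EssIdeal I) : ∃ c ∈ lReg R, c ∈ I := by
  obtain ⟨N, d, hN, hd⟩ := aux_dim hud
  obtain ⟨A, ⟨hAI, c, hcA, hc⟩, hmin⟩ := (measure d).wf.has_min
    {A : Submodule R R | A ≤ I ∧ ∃ c ∈ A, ∀ x ∈ A, x * c = 0 → x = 0}
    ⟨⊥, bot_le, 0, by simp, by simp⟩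
  refine ⟨c, ?_, hAI hcA⟩
  let L : Submodule R R := LinearMap.ker (LinearMap.toSpanSingleton R R c)
  have hL : ∀ x, x ∈ L ↔ x * c = 0 := by intro x; simp [L]
  by_contra hnot
  have hL0 : L ≠ ⊥ := by
    intro h
    apply hnot
    intro x hx
    rw [← hL, h] at hx
    simpa using hx
  obtain ⟨U, hUL, hU⟩ := aux_uniform hud _ (hI L hL0)
  obtain ⟨u, huU, hu⟩ := huni U hU
  have hAU : Disjoint A U := by
    rw [Submodule.disjoint_def]
    intro x hxA hxU
    exact hc x hxA ((hL x).1 (hUL hxU).2)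
  have h1 := hd A U (A ⊔ U) le_sup_left le_sup_right hU.1 hAU
  refine hmin (A ⊔ U) ⟨sup_le hAI (hUL.trans inf_le_left), c + u,
    Submodule.add_mem_sup hcA huU, ?_⟩ h1
  intro x hx h0
  obtain ⟨a, ha, v, hv, rfl⟩ := Submodule.mem_sup.1 hx
  have hvc : v * c = 0 := (hL v).1 (hUL hv).2
  have e : a * c + (a * u + v * u) = 0 := by
    have : (a + v) * (c + u) = a * c + (a * u + v * u) + v * c := by noncomm_ring
    rw [← h0, this, hvc, add_zero]
  have hac : a * c = 0 := by
    refine Submodule.disjoint_def.1 hAU _ (A.smul_mem a hcA) ?_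
    rw [eq_neg_of_add_eq_zero_left e]
    exact U.neg_mem (U.add_mem (U.smul_mem a huU) (U.smul_mem v huU))
  have ha0 := hc a ha hac
  subst ha0
  simp only [zero_mul, zero_add] at e ⊢
  exact hu v hv e

lemma aux_span_ess (hud : FinUdim R) (c : R) (hc : c ∈ lReg R) :
    EssIdeal (Submodule.span R {c}) := by
  obtain ⟨N, d, hN, hd⟩ := aux_dim hud
  intro X hX0 h
  have hpow : ∀ k x, x * c ^ k = 0 → x = 0 := by
    intro k
    induction k with
    | zero => intro x hx; simpa using hx
    | succ k ih => intro x hx; rw [pow_succ, ← mul_assoc] at hx; exact ih x (hc _ hx)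
  have step : ∀ k, k ≤ d (Submodule.span R {c ^ k}) := by
    intro k
    induction k with
    | zero => simp
    | succ k ih =>
      refine lt_of_le_of_lt ih (hd _ (X.map (LinearMap.toSpanSingleton R R (c ^ k))) _ ?_ ?_ ?_ ?_)
      · rw [Submodule.span_singleton_le_iff_mem, pow_succ', Submodule.mem_span_singleton]
        exact ⟨c, rfl⟩
      · rintro _ ⟨x, hx, rfl⟩
        exact Submodule.mem_span_singleton.2 ⟨x, rfl⟩
      · obtain ⟨x, hx, hx0⟩ := (Submodule.ne_bot_iff _).1 hX0
        exact (Submodule.ne_bot_iff _).2 ⟨x * c ^ k, ⟨x, hx, rfl⟩, fun h => hx0 (hpow k x h)⟩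
      · rw [Submodule.disjoint_def]
        rintro y hy ⟨x, hx, rfl⟩
        obtain ⟨r, hr⟩ := Submodule.mem_span_singleton.1 hy
        simp only [LinearMap.toSpanSingleton_apply, smul_eq_mul] at hr ⊢
        have h1 : (r * c - x) * c ^ k = 0 := by
          rw [sub_mul, mul_assoc, ← pow_succ', hr, sub_self]
        have h2 := sub_eq_zero.1 (hpow k _ h1)
        have h3 : x ∈ Submodule.span R {c} ⊓ X :=
          ⟨Submodule.mem_span_singleton.2 ⟨r, h2⟩, hx⟩
        rw [h] at h3
        rw [(Submodule.mem_bot R).1 h3, zero_mul]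
  have := (step (N + 1)).trans (hN _)
  omega

lemma aux_comap_ess (E : Submodule R R) (hE : EssIdeal E) (r : R) :
    EssIdeal (E.comap (LinearMap.toSpanSingleton R R r)) := by
  intro X hX0
  obtain ⟨x, hx, hx0⟩ := (Submodule.ne_bot_iff _).1 hX0
  rw [Submodule.ne_bot_iff]
  by_cases hxr : x * r = 0
  · exact ⟨x, ⟨by simp [hxr], hx⟩, hx0⟩
  · obtain ⟨y, ⟨hy1, hy2⟩, hy0⟩ := (Submodule.ne_bot_iff _).1
      (hE (Submodule.span R {x * r}) (by simpa using hxr))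
    obtain ⟨s, rfl⟩ := Submodule.mem_span_singleton.1 hy2
    refine ⟨s * x, ⟨by simpa [mul_assoc] using hy1, X.smul_mem s hx⟩, ?_⟩
    intro h
    apply hy0
    rw [smul_eq_mul, ← mul_assoc, h, zero_mul]

lemma aux_nontriv (hud : FinUdim R) : (1 : R) ≠ 0 := by
  obtain ⟨n, U, hU, -, -⟩ := hud
  intro h
  apply (hU 0).1
  rw [eq_bot_iff]
  intro x _
  rw [Submodule.mem_bot, ← mul_one x, h, mul_zero]

lemma aux_denom (hud : FinUdim R)
    (huni : ∀ U : Submodule R R, UniformIdeal U → (lRegIn U).Nonempty) :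
    IsLeftDenom (lReg R) := by
  refine ⟨⟨⟨fun x hx => by simpa using hx, fun a ha b hb x hx => ?_, fun h => ?_⟩, ?_⟩, ?_⟩
  · rw [← mul_assoc] at hx
    exact ha _ (hb _ hx)
  · exact aux_nontriv hud (h 1 (by simp))
  · intro s hs r
    obtain ⟨s', hs', hm⟩ := aux_ess_meets hud huni _
      (aux_comap_ess _ (aux_span_ess hud s hs) r)
    obtain ⟨r', hr'⟩ := Submodule.mem_span_singleton.1 (Submodule.mem_comap.1 hm)
    exact ⟨s', hs', r', by simpa using hr'.symm⟩
  · intro r s hs h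
    exact ⟨1, fun x hx => by simpa using hx, by rw [hs r h, mul_zero]⟩

lemma aux_semisimple (hess : ∀ I : Submodule R R, EssIdeal I → ∃ c ∈ lReg R, c ∈ I)
    {Q : Type u} [Ring Q] (f : R →+* Q) (hf : IsLeftLoc (lReg R) f) : IsSemisimpleRing Q := by
  obtain ⟨hu, hfr, hk⟩ := hf
  have noess : ∀ E : Submodule Q Q, (∀ X : Submodule Q Q, X ≠ ⊥ → E ⊓ X ≠ ⊥) → E = ⊤ := by
    intro E hE
    let I : Submodule R R :=
      { carrier := {r | f r ∈ E}
        add_mem' := fun {a b} ha hb => by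
          simp only [Set.mem_ofPred_eq, map_add] at *; exact E.add_mem ha hb
        zero_mem' := by simp
        smul_mem' := fun c x hx => by
          simp only [Set.mem_ofPred_eq, smul_eq_mul, map_mul] at *; exact E.smul_mem _ hx }
    have hI : ∀ r, r ∈ I ↔ f r ∈ E := fun r => Iff.rfl
    obtain ⟨c, hc, hcI⟩ := hess I (by
      intro X hX0
      obtain ⟨x, hx, hx0⟩ := (Submodule.ne_bot_iff _).1 hX0
      rw [Submodule.ne_bot_iff]
      by_cases hfx : f x = 0
      · exact ⟨x, ⟨by rw [SetLike.mem_coe, hI, hfx]; exact E.zero_mem, hx⟩, hx0⟩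
      · obtain ⟨y, ⟨hy1, hy2⟩, hy0⟩ := (Submodule.ne_bot_iff _).1
          (hE (Submodule.span Q {f x}) (by simpa using hfx))
        obtain ⟨q, rfl⟩ := Submodule.mem_span_singleton.1 hy2
        obtain ⟨s, hs, r, hr⟩ := hfr q
        have e : f (r * x) = f s * (q * f x) := by rw [map_mul, ← hr, mul_assoc]
        refine ⟨r * x, ⟨?_, X.smul_mem r hx⟩, ?_⟩
        · rw [SetLike.mem_coe, hI, e]
          exact E.smul_mem (f s) hy1
        · intro h
          rw [h, map_zero] at e
          exact hy0 ((hu s hs).mul_right_eq_zero.1 e.symm))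
    exact Ideal.eq_top_of_isUnit_mem E hcI (hu c hc)
  have hC : ComplementedLattice (Submodule Q Q) := by
    refine ⟨fun J => ?_⟩
    obtain ⟨K, -, hK⟩ := zorn_le_nonempty₀ {K : Submodule Q Q | Disjoint J K} (by
      intro c hc hchain y hy
      refine ⟨sSup c, ?_, fun z hz => le_sSup hz⟩
      exact (hchain.directedOn.disjoint_sSup_right).2 fun b hb => hc hb) ⊥ disjoint_bot_right
    refine ⟨K, hK.prop, codisjoint_iff.2 (noess _ ?_)⟩
    intro X hX0 h
    have h1 : Disjoint J (K ⊔ X) :=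
      Disjoint.disjoint_sup_right_of_disjoint_sup_left hK.prop (disjoint_iff.2 h)
    have h2 : K ⊔ X ≤ K := hK.le_of_ge h1 le_sup_left
    have h3 : X ≤ J ⊔ K := (le_sup_right.trans h2).trans le_sup_right
    rw [inf_eq_right.2 h3] at h
    exact hX0 h
  exact (isSemisimpleModule_iff Q Q).2 hC

end Aux

section Aux2

variable {R : Type u} [Ring R]

lemma aux_loc (S : Set R) (hS : IsLeftDenom S) :
    ∃ (Q : Type u) (_ : Ring Q) (f : R →+* Q), IsLeftLoc S f ∧
      ∀ (T : Type u) (_ : Ring T) (g : R →+* T), IsLeftLoc S g →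
        ∃ φ : Q ≃+* T, ∀ r, φ (f r) = g r := by
  let M : Submonoid R :=
    { carrier := S
      one_mem' := hS.1.1.1
      mul_mem' := fun {a b} ha hb => hS.1.1.2.1 a ha b hb }
  have hM : Nonempty (OreLocalization.OreSet M) := by
    rw [OreLocalization.nonempty_oreSet_iff]
    constructor
    · rintro r₁ r₂ ⟨s, hs⟩ h
      obtain ⟨t, ht, h2⟩ := hS.2 (r₁ - r₂) s hs (by rw [sub_mul]; exact sub_eq_zero.2 h)
      exact ⟨⟨t, ht⟩, by rw [mul_sub] at h2; exact sub_eq_zero.1 h2⟩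
    · rintro r ⟨s, hs⟩
      obtain ⟨s', hs', r', h⟩ := hS.1.2 s hs r
      exact ⟨r', ⟨s', hs'⟩, h⟩
  obtain ⟨inst⟩ := hM
  have hfloc : IsLeftLoc S (OreLocalization.numeratorRingHom : R →+* OreLocalization M R) := by
    refine ⟨fun s hs => OreLocalization.numerator_isUnit (⟨s, hs⟩ : M), fun q => ?_, fun r => ?_⟩
    · induction q using OreLocalization.ind with
      | _ r s =>
        refine ⟨s, s.2, r, ?_⟩
        change ((s : R) /ₒ (1 : M)) * (r /ₒ s) = r /ₒ (1 : M)
        exact OreLocalization.mul_cancel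
    · change r /ₒ (1 : M) = 0 ↔ _
      constructor
      · intro h
        rw [OreLocalization.zero_def, eq_comm, OreLocalization.oreDiv_eq_iff] at h
        obtain ⟨u, v, h1, h2⟩ := h
        exact ⟨u, u.2, by simpa [Submonoid.smul_def] using h1⟩
      · rintro ⟨s, hs, h⟩
        rw [OreLocalization.zero_def, eq_comm, OreLocalization.oreDiv_eq_iff]
        exact ⟨⟨s, hs⟩, s, by simpa [Submonoid.smul_def] using h, by simp⟩
  refine ⟨OreLocalization M R, inferInstance, OreLocalization.numeratorRingHom, hfloc, ?_⟩
  intro T _ g hg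
  let fS : M →* Tˣ :=
    IsUnit.liftRight ((g : R →* T).comp M.subtype) (fun s => hg.1 s s.2)
  have hfS : ∀ s : M, g s = fS s := fun s => rfl
  let φ := OreLocalization.universalHom g fS hfS
  have hφ : ∀ r, φ (OreLocalization.numeratorRingHom r) = g r :=
    fun r => OreLocalization.universalHom_commutes g fS hfS
  refine ⟨RingEquiv.ofBijective φ ⟨?_, ?_⟩, hφ⟩
  · rw [injective_iff_map_eq_zero]
    intro q hq
    obtain ⟨s, hs, r, h⟩ := hfloc.2.1 q
    have h1 : g r = 0 := by rw [← hφ, ← h, map_mul, hq, mul_zero]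
    rw [hg.2.2, ← hfloc.2.2] at h1
    rw [h1] at h
    exact (hfloc.1 s hs).mul_right_eq_zero.1 h
  · intro t
    obtain ⟨s, hs, r, h⟩ := hg.2.1 t
    obtain ⟨w, hw⟩ := hfloc.1 s hs
    refine ⟨(↑w⁻¹ : OreLocalization M R) * OreLocalization.numeratorRingHom r, ?_⟩
    apply (hg.1 s hs).mul_left_cancel
    rw [h, ← hφ s, ← hφ r, ← map_mul, ← hw, Units.mul_inv_cancel_left]

lemma aux_unit {S : Set R} {Q : Type u} [Ring Q] [IsSemisimpleRing Q] (f : R →+* Q)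
    (hf : IsLeftLoc S f) (c : R) (hc : ∀ r, r * c ∈ ass S → r ∈ ass S) : IsUnit (f c) := by
  have hinj : ∀ q : Q, q * f c = 0 → q = 0 := by
    intro q hq
    obtain ⟨s, hs, r, h⟩ := hf.2.1 q
    have h1 : f (r * c) = 0 := by rw [map_mul, ← h, mul_assoc, hq, mul_zero]
    have h2 := (hf.2.2 r).2 (hc r ((hf.2.2 _).1 h1))
    rw [h2] at h
    exact (hf.1 s hs).mul_right_eq_zero.1 h
  have hsurj : Function.Surjective (LinearMap.toSpanSingleton Q Q (f c)) := by
    apply IsArtinian.surjective_of_injective_endomorphism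
    rw [injective_iff_map_eq_zero]
    exact hinj
  obtain ⟨q, hq⟩ := hsurj 1
  have hq : q * f c = 1 := hq
  have hq' : f c * q = 1 := by
    refine sub_eq_zero.1 (hinj _ ?_)
    rw [sub_mul, mul_assoc, hq, mul_one, one_mul, sub_self]
  exact ⟨⟨f c, q, hq', hq⟩, rfl⟩

lemma aux_ideal {S : Set R} {Q : Type u} [Ring Q] (f : R →+* Q)
    (hf : IsLeftLoc S f) : IsIdealSet (ass S) := by
  refine ⟨?_, ?_, ?_⟩
  · rw [← hf.2.2, map_zero]
  · intro x hx y hy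
    rw [← hf.2.2] at *
    rw [map_add, hx, hy, add_zero]
  · intro r x hx
    rw [← hf.2.2] at hx
    constructor <;> rw [← hf.2.2, map_mul, hx] <;> simp

lemma aux_semiprime {S : Set R} {Q : Type u} [Ring Q] (f : R →+* Q)
    (hf : IsLeftLoc S f) (hess : ∀ I : Submodule R R, EssIdeal I → ∃ c ∈ S, c ∈ I)
    (x : R) (hx : ∀ r, x * r * x ∈ ass S) : x ∈ ass S := by
  have ha := aux_ideal f hf
  let K : Submodule R R :=
    { carrier := {r | ∀ t, x * t * r ∈ ass S}
      add_mem' := fun {a b} h1 h2 t => by rw [mul_add]; exact ha.2.1 _ (h1 t) _ (h2 t)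
      zero_mem' := fun t => by rw [mul_zero]; exact ha.1
      smul_mem' := fun c y hy t => by
        have := hy (t * c)
        rwa [smul_eq_mul, ← mul_assoc, mul_assoc x] }
  obtain ⟨s, hs, hsK⟩ := hess K (by
    intro X hX0
    rw [Submodule.ne_bot_iff]
    by_cases h : X ≤ K
    · obtain ⟨y, hy, hy0⟩ := (Submodule.ne_bot_iff _).1 hX0
      exact ⟨y, ⟨h hy, hy⟩, hy0⟩
    · obtain ⟨y, hy, hyK⟩ := Set.not_subset.1 h
      obtain ⟨t, ht⟩ : ∃ t, x * t * y ∉ ass S := by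
        by_contra hcon
        push Not at hcon
        exact hyK hcon
      refine ⟨x * t * y, ⟨fun t' => ?_, X.smul_mem (x * t) hy⟩, ?_⟩
      · have := (ha.2.2 (t * y) _ (hx t')).2
        simpa only [mul_assoc] using this
      · intro h0
        rw [h0] at ht
        exact ht ha.1)
  have h1 := hsK 1
  rw [mul_one, ← hf.2.2, map_mul, (hf.1 s hs).mul_left_eq_zero, hf.2.2] at h1
  exact h1

lemma aux_primeRad (a : Set R) (ha0 : (0 : R) ∈ a)
    (hsp : ∀ x : R, (∀ r : R, x * r * x ∈ a) → x ∈ a) : primeRadical R ⊆ a := by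
  intro x hx
  by_contra hxa
  have hstep : ∀ y : {y : R // y ∉ a}, ∃ r, y.1 * r * y.1 ∉ a := by
    intro y
    by_contra h
    push Not at h
    exact y.2 (hsp _ h)
  choose g hg using hstep
  let X : ℕ → {y : R // y ∉ a} := fun n => Nat.rec ⟨x, hxa⟩ (fun _ y => ⟨y.1 * g y * y.1, hg y⟩) n
  have hX0 : (X 0).1 = x := rfl
  have hXs : ∀ n, (X (n + 1)).1 = (X n).1 * g (X n) * (X n).1 := fun n => rfl
  have hbot : IsIdealSet ({0} : Set R) := by
    refine ⟨rfl, ?_, ?_⟩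
    · rintro x rfl y rfl; simp
    · rintro r x rfl; simp
  obtain ⟨p, -, hp⟩ := zorn_subset_nonempty
    {p : Set R | IsIdealSet p ∧ ∀ n, (X n).1 ∉ p} (by
      intro c hc hchain ⟨p0, hp0⟩
      refine ⟨⋃₀ c, ⟨⟨⟨p0, hp0, (hc hp0).1.1⟩, ?_, ?_⟩, ?_⟩, fun s hs => Set.subset_sUnion_of_mem hs⟩
      · rintro y ⟨p1, hp1, hy⟩ z ⟨p2, hp2, hz⟩
        rcases hchain.total hp1 hp2 with h | h
        · exact ⟨p2, hp2, (hc hp2).1.2.1 _ (h hy) _ hz⟩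
        · exact ⟨p1, hp1, (hc hp1).1.2.1 _ hy _ (h hz)⟩
      · rintro r y ⟨p1, hp1, hy⟩
        exact ⟨⟨p1, hp1, ((hc hp1).1.2.2 r y hy).1⟩, ⟨p1, hp1, ((hc hp1).1.2.2 r y hy).2⟩⟩
      · rintro n ⟨p1, hp1, hy⟩
        exact (hc hp1).2 n hy) {0} ⟨hbot, fun n h => (X n).2 (by rw [Set.mem_singleton_iff.1 h]; exact ha0)⟩
  obtain ⟨hpI, hpX⟩ := hp.prop
  have hmax : ∀ q : Set R, IsIdealSet q → p ⊆ q → ∀ y ∈ q, y ∉ p → ∃ n, (X n).1 ∈ q := by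
    intro q hq hpq y hyq hyp
    by_contra h
    push Not at h
    exact hyp (hp.le_of_ge ⟨hq, h⟩ hpq hyq)
  have hmono : ∀ i k, ∃ u v, (X (i + k)).1 = u * (X i).1 ∧ (X (i + k)).1 = (X i).1 * v := by
    intro i k
    induction k with
    | zero => exact ⟨1, 1, by simp, by simp⟩
    | succ k ih =>
      obtain ⟨u, v, h1, h2⟩ := ih
      refine ⟨(X (i + k)).1 * g (X (i + k)) * u, v * g (X (i + k)) * (X (i + k)).1, ?_, ?_⟩
      · rw [← add_assoc, hXs]
        nth_rewrite 2 [h1]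
        simp only [mul_assoc]
      · rw [← add_assoc, hXs]
        nth_rewrite 1 [h2]
        simp only [mul_assoc]
  have hprime : IsPrimeIdealSet p := by
    refine ⟨hpI, fun h => hpX 0 (h ▸ Set.mem_univ _), ?_⟩
    intro y z hyz
    by_contra hcon
    push Not at hcon
    obtain ⟨i, hi⟩ := hmax {w | ∀ r, w * r * z ∈ p} (by
      refine ⟨fun r => by simpa using hpI.1, fun b hb c hc r => ?_, fun t b hb => ⟨fun r => ?_, fun r => ?_⟩⟩
      · rw [add_mul, add_mul]; exact hpI.2.1 _ (hb r) _ (hc r)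
      · have := (hpI.2.2 t _ (hb r)).1
        simpa only [mul_assoc] using this
      · have := hb (t * r)
        simpa only [mul_assoc] using this) (fun b hb r => by
          rw [mul_assoc]; exact (hpI.2.2 _ _ hb).2) y hyz hcon.1
    obtain ⟨j, hj⟩ := hmax {w | ∀ r, (X i).1 * r * w ∈ p} (by
      refine ⟨fun r => by simpa using hpI.1, fun b hb c hc r => ?_, fun t b hb => ⟨fun r => ?_, fun r => ?_⟩⟩
      · rw [mul_add]; exact hpI.2.1 _ (hb r) _ (hc r)
      · have := hb (r * t)
        simpa only [mul_assoc] using this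
      · have := (hpI.2.2 t _ (hb r)).2
        simpa only [mul_assoc] using this) (fun b hb r => (hpI.2.2 _ _ hb).1) z hi hcon.2
    obtain ⟨u, -, h1, -⟩ := hmono i j
    obtain ⟨-, v, -, h2⟩ := hmono j i
    rw [add_comm] at h2
    apply hpX (i + j + 1)
    have h3 := (hpI.2.2 v _ (hpI.2.2 u _ (hj (g (X (i + j))))).1).2
    have e : (X (i + j + 1)).1 = u * ((X i).1 * g (X (i + j)) * (X j).1) * v := by
      rw [hXs]
      nth_rewrite 1 [h1]
      rw [h2]
      simp only [mul_assoc]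
    rw [e]
    exact h3
  exact hpX 0 (hx p hprime)

end Aux2

/-- Theorem A26Feb15: if `udim(_R R) < ∞` and `'C_U ≠ ∅` for all uniform left ideals
`U` of `R`, then `'C_R` is a left denominator set, `'Q = 'C_R⁻¹R` is semisimple Artinian,
`'Q ≅ Q_{l,cl}(R/a)` (an `R`-isomorphism), every essential left ideal meets `'C_R`, and
the prime radical is contained in `a = ass_R('C_R)`. -/
theorem leftRegular_isDenominator_of_finUdim {R : Type u} [Ring R]
    (hud : FinUdim R)
    (huni : ∀ U : Submodule R R, UniformIdeal U → (lRegIn U).Nonempty) :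
    -- (1)
    (IsLeftDenom (lReg R) ∧ IsIdealSet (ass (lReg R)) ∧
      ∃ (Q : Type u) (_ : Ring Q) (f : R →+* Q),
        IsLeftLoc (lReg R) f ∧ IsSemisimpleRing Q) ∧
    -- (2)  'Q ≅ Q_{l,cl}(R/a), an R-isomorphism
    ((∃ (Rb : Type u) (_ : Ring Rb) (π : R →+* Rb), IsQuotBy (ass (lReg R)) π) ∧
      ∀ (Rb : Type u) (_ : Ring Rb) (π : R →+* Rb), IsQuotBy (ass (lReg R)) π →
        IsLeftOre (reg Rb) ∧
        ∀ (Q1 : Type u) (_ : Ring Q1) (f1 : R →+* Q1), IsLeftLoc (lReg R) f1 →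
          ∀ (Q2 : Type u) (_ : Ring Q2) (f2 : Rb →+* Q2), IsLeftLoc (reg Rb) f2 →
            ∃ φ : Q1 ≃+* Q2, ∀ r : R, φ (f1 r) = f2 (π r)) ∧
    -- (3)
    (∀ I : Submodule R R, EssIdeal I → ∃ c ∈ lReg R, c ∈ I) ∧
    -- (4)
    primeRadical R ⊆ ass (lReg R) := by
  have hD := aux_denom hud huni
  have hess := aux_ess_meets hud huni
  obtain ⟨Q, instQ, f, hf, huniv⟩ := aux_loc (lReg R) hD
  have hss : IsSemisimpleRing Q := aux_semisimple hess f hf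
  have hI := aux_ideal f hf
  refine ⟨⟨hD, hI, Q, instQ, f, hf, hss⟩, ⟨⟨f.range, inferInstance, f.rangeRestrict,
    f.rangeRestrict_surjective, fun r => ?_⟩, ?_⟩, hess,
    aux_primeRad _ hI.1 (aux_semiprime f hf hess)⟩
  · rw [← hf.2.2, ← Subtype.coe_inj]
    rfl
  intro Rb _ π hπ
  obtain ⟨hsurj, hker⟩ := hπ
  have hkf : ∀ r, π r = 0 ↔ f r = 0 := fun r => (hker r).trans (hf.2.2 r).symm
  -- elements regular modulo the kernel become units
  have hunit : ∀ c, π c ∈ reg Rb → IsUnit (f c) := by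
    intro c hc
    refine aux_unit f hf c fun r hr => ?_
    rw [← hker] at hr ⊢
    rw [map_mul] at hr
    exact hc.1 _ hr
  have hreg : ∀ s ∈ lReg R, π s ∈ reg Rb := by
    intro s hs
    constructor
    · intro x hx
      obtain ⟨x, rfl⟩ := hsurj x
      rw [← map_mul, hkf, map_mul, (hf.1 s hs).mul_left_eq_zero] at hx
      exact (hkf x).2 hx
    · intro x hx
      obtain ⟨x, rfl⟩ := hsurj x
      rw [← map_mul, hkf, map_mul, (hf.1 s hs).mul_right_eq_zero] at hx
      exact (hkf x).2 hx
  have hfrac : ∀ c, π c ∈ reg Rb → ∀ r, ∃ s ∈ lReg R, ∃ r', π s * π r = π r' * π c := by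
    intro c hc r
    obtain ⟨w, hw⟩ := hunit c hc
    obtain ⟨s, hs, r', h⟩ := hf.2.1 (f r * (↑w⁻¹ : Q))
    refine ⟨s, hs, r', ?_⟩
    have h2 : f (s * r - r' * c) = 0 := by
      rw [map_sub, map_mul, map_mul, ← h, ← hw]
      simp [mul_assoc]
    rw [← hkf, map_sub, map_mul, map_mul, sub_eq_zero] at h2
    exact h2
  have hone : (1 : Rb) ≠ 0 := by
    intro h
    rw [← map_one π, hker] at h
    obtain ⟨s, hs, h⟩ := h
    rw [mul_one] at h
    rw [h] at hs
    exact hD.1.1.2.2 hs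
  refine ⟨⟨⟨⟨fun x hx => by simpa using hx, fun x hx => by simpa using hx⟩, ?_, ?_⟩, ?_⟩, ?_⟩
  · intro b hb c hc
    exact ⟨fun x hx => hb.1 _ (hc.1 _ (by rwa [mul_assoc])),
      fun x hx => hc.2 _ (hb.2 _ (by rwa [← mul_assoc]))⟩
  · intro h
    exact hone (h.1 1 (by simp))
  · intro c hc r
    obtain ⟨c, rfl⟩ := hsurj c
    obtain ⟨r, rfl⟩ := hsurj r
    obtain ⟨s, hs, r', h⟩ := hfrac c hc r
    exact ⟨π s, hreg s hs, π r', h⟩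
  · intro Q1 _ f1 hf1 Q2 _ f2 hf2
    have hf2' : IsLeftLoc (lReg R) (f2.comp π) := by
      refine ⟨fun s hs => hf2.1 _ (hreg s hs), fun q => ?_, fun r => ?_⟩
      · obtain ⟨c, hc, r, h⟩ := hf2.2.1 q
        obtain ⟨c, rfl⟩ := hsurj c
        obtain ⟨r, rfl⟩ := hsurj r
        obtain ⟨s, hs, r', h'⟩ := hfrac c hc 1
        refine ⟨s, hs, r' * r, ?_⟩
        rw [map_one, mul_one] at h'
        simp only [RingHom.comp_apply, map_mul]
        rw [h', map_mul, mul_assoc, h]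
      · rw [RingHom.comp_apply, hf2.2.2, ← hker]
        constructor
        · rintro ⟨c, hc, h⟩
          exact hc.2 _ h
        · intro h
          exact ⟨π 1, hreg 1 hD.1.1.1, by rw [h, mul_zero]⟩
    obtain ⟨φ1, h1⟩ := huniv Q1 _ f1 hf1
    obtain ⟨φ2, h2⟩ := huniv Q2 _ _ hf2'
    refine ⟨φ1.symm.trans φ2, fun r => ?_⟩
    rw [RingEquiv.trans_apply, ← h1, RingEquiv.symm_apply_apply, h2]
    rfl

end Bavula
end
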